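/- Let ℙ be a probability measure on Ω₊ under which (ω(x))_{x≥0} is stationary and ergodic. Then P_0-almost surely, X_n/n converges as n → ∞ to the deterministic speed v := 1/u ≥ 0, where u := Σ_{j≥1} P_0[T_{j+1} − T_j ≥ j] ∈ [1, ∞] (with the convention v = 0 when u = ∞). -/

import Mathlib

open MeasureTheory Filter Set Topology ProbabilityTheory
open scoped ENNReal ENat

noncomputable section

/-- A cookie environment: `ω z i` is the strength of the `(i+1)`-st cookie at site `z`
(cookies at each site are indexed by `i = 0, 1, 2, …`). -/
abbrev CEnv : Type := ℤ → ℕ → ℝ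

/-- `ω` belongs to `Ω₊`, i.e. all cookie strengths lie in `[1/2, 1]`. -/
def IsCookieEnv (ω : CEnv) : Prop := ∀ z i, ω z i ∈ Set.Icc (1/2 : ℝ) 1

/-- The number of visits of the path `x` to the site `x n` at times `m < n`. -/
def prevVisits (x : ℕ → ℤ) (n : ℕ) : ℕ :=
  ((Finset.range n).filter fun m => x m = x n).card

/-- The probability of the step from `x n` to `x (n+1)` for the multi-excited random
walk: jump to the right with the strength of the bottom remaining cookie at the current
site, to the left with the complementary probability. -/
def stepProb (ω : CEnv) (x : ℕ → ℤ) (n : ℕ) : ℝ :=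
  if x (n+1) = x n + 1 then ω (x n) (prevVisits x n)
  else if x (n+1) = x n - 1 then 1 - ω (x n) (prevVisits x n)
  else 0

/-- The probability that the walk started at `x0` follows the path `x` up to time `n`. -/
def cylProb (ω : CEnv) (x0 : ℤ) (x : ℕ → ℤ) (n : ℕ) : ℝ :=
  (if x 0 = x0 then 1 else 0) * ∏ m ∈ Finset.range n, stepProb ω x m

/-- `P` is the law `P_{x0,ω}` of the multi-excited random walk in the cookie
environment `ω` started at `x0`, characterized by its cylinder probabilities. -/
def IsERWLaw (ω : CEnv) (x0 : ℤ) (P : Measure (ℕ → ℤ)) : Prop :=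
  IsProbabilityMeasure P ∧
    ∀ (x : ℕ → ℤ) (n : ℕ),
      P {Y | ∀ m ≤ n, Y m = x m} = ENNReal.ofReal (cylProb ω x0 x n)

/-- First passage time `T_k`, with value `∞` if `k` is never visited. -/
def T (k : ℤ) (Y : ℕ → ℤ) : ℕ∞ :=
  sInf {t : ℕ∞ | ∃ n : ℕ, (n : ℕ∞) = t ∧ Y n = k}

/-- First passage time of an extended-real level, with the convention
`T_{−∞} = T_{+∞} = ∞`. -/
def Te (k : EReal) (Y : ℕ → ℤ) : ℕ∞ :=
  sInf {t : ℕ∞ | ∃ n : ℕ, (n : ℕ∞) = t ∧ ((Y n : ℝ) : EReal) = k}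

/-- `R_k`, the event that the site `k` is visited infinitely often. -/
def Rset (k : ℤ) : Set (ℕ → ℤ) := {Y | ∀ N : ℕ, ∃ n ≥ N, Y n = k}

/-- The number of visits of `Y` to the site `s` at times `< t`. -/
def visitsBefore (Y : ℕ → ℤ) (s : ℤ) (t : ℕ∞) : ℕ∞ :=
  {m : ℕ | (m : ℕ∞) < t ∧ Y m = s}.encard

/-- `D_t^s`: the total drift stored in the cookies consumed at the site `s`
before time `t` (a time in `ℕ∞`; `t = ∞` gives `D_∞^s`). -/
def driftAt (ω : CEnv) (Y : ℕ → ℤ) (s : ℤ) (t : ℕ∞) : ℝ≥0∞ :=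
  ∑' i : ℕ, Set.indicator {i : ℕ | (i : ℕ∞) < visitsBefore Y s t}
    (fun i => ENNReal.ofReal (2 * ω s i - 1)) i

/-- `D_t`: the total drift consumed before time `t` (at all sites). -/
def Dtot (ω : CEnv) (Y : ℕ → ℤ) (t : ℕ∞) : ℝ≥0∞ := ∑' s : ℤ, driftAt ω Y s t

/-- `D_t^+`: the total drift consumed at nonnegative sites before time `t`. -/
def DtotPos (ω : CEnv) (Y : ℕ → ℤ) (t : ℕ∞) : ℝ≥0∞ := ∑' s : ℕ, driftAt ω Y (s : ℤ) t

/-- `δ^s`: the total drift stored in the cookies at the site `s`. -/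
def cookieDrift (ω : CEnv) (s : ℤ) : ℝ≥0∞ := ∑' i : ℕ, ENNReal.ofReal (2 * ω s i - 1)

/-- The successive times `τ_{k,1}, τ_{k,2}, …` (indexed here from `0`) at which the
walk is at a site `≥ k`. -/
def tauT (k : ℤ) (Y : ℕ → ℤ) : ℕ → ℕ∞
  | 0 => sInf {t : ℕ∞ | ∃ n : ℕ, (n : ℕ∞) = t ∧ k ≤ Y n}
  | m + 1 => sInf {t : ℕ∞ | ∃ n : ℕ, (n : ℕ∞) = t ∧ tauT k Y m < (n : ℕ∞) ∧ k ≤ Y n}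

/-- The observed sequence `(X_{τ_{k,m}})_{m ≥ 1}` (indexed here from `0`). -/
def obsSeq (k : ℤ) (Y : ℕ → ℤ) (m : ℕ) : ℤ := Y (tauT k Y m).toNat

/-- The one-sided shift on sequences. -/
def shiftSeq {α : Type*} (u : ℕ → α) : ℕ → α := fun n => u (n + 1)

/-- The restriction `(ω(x))_{x ≥ 0}` of an environment to the nonnegative sites. -/
def restrictNN (ω : CEnv) : ℕ → ℕ → ℝ := fun x => ω (x : ℤ)

/-- `(ω(x))_{x ≥ 0}` is stationary under `Pr`: its law is invariant under the shift. -/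
def IsStationaryEnv (Pr : Measure CEnv) : Prop :=
  MeasurePreserving shiftSeq (Pr.map restrictNN) (Pr.map restrictNN)

/-- `(ω(x))_{x ≥ 0}` is stationary and ergodic under `Pr`. -/
def IsStatErgEnv (Pr : Measure CEnv) : Prop :=
  Ergodic shiftSeq (Pr.map restrictNN)

/-- The process `ξ_k = ((ω(x+k))_{x≥0}, (X_{τ_{k,m}} − k)_{m≥0})` consisting of the
environment to the right of `k` and the trajectory at sites `≥ k`, recentered at `k`. -/
def xiProc (p : CEnv × (ℕ → ℤ)) (k : ℕ) : (ℕ → ℕ → ℝ) × (ℕ → ℤ) :=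
  (fun x : ℕ => p.1 ((x : ℤ) + (k : ℤ)), fun m => obsSeq (k : ℤ) p.2 m - (k : ℤ))

section MaximalErgodic

variable {α : Type*}

/-- The running maximum of `0` and the first `n` Birkhoff sums of `g` along `f`. -/
def birkhoffMax (f : α → α) (g : α → ℝ) : ℕ → α → ℝ
  | 0 => fun _ => 0
  | n + 1 => fun x => max 0 (g x + birkhoffMax f g n (f x))

lemma birkhoffMax_nonneg (f : α → α) (g : α → ℝ) (n : ℕ) (x : α) : 0 ≤ birkhoffMax f g n x := by
  cases n with
  | zero => exact le_rfl
  | succ n => exact le_max_left _ _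

lemma birkhoffMax_le_succ (f : α → α) (g : α → ℝ) (n : ℕ) (x : α) :
    birkhoffMax f g n x ≤ birkhoffMax f g (n + 1) x := by
  induction n generalizing x with
  | zero => exact birkhoffMax_nonneg f g 1 x
  | succ n ih => exact max_le_max le_rfl (by linarith [ih (f x)])

lemma birkhoffSum_le_birkhoffMax (f : α → α) (g : α → ℝ) (n : ℕ) (x : α) :
    birkhoffSum f g n x ≤ birkhoffMax f g n x := by
  induction n generalizing x with
  | zero => simp [birkhoffMax]
  | succ n ih =>
    rw [birkhoffSum_succ']
    exact le_max_of_le_right (by linarith [ih (f x)])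

variable [MeasurableSpace α] {μ : Measure α} {f : α → α} {g : α → ℝ}

lemma measurable_birkhoffMax (hf : Measurable f) (hg : Measurable g) (n : ℕ) :
    Measurable (birkhoffMax f g n) := by
  induction n with
  | zero => exact measurable_const
  | succ n ih => exact measurable_const.max (hg.add (ih.comp hf))

lemma integrable_birkhoffMax [IsFiniteMeasure μ] (hf : MeasurePreserving f μ μ)
    (hg : Integrable g μ) (n : ℕ) : Integrable (birkhoffMax f g n) μ := by
  induction n with
  | zero => exact integrable_const _
  | succ n ih => exact (integrable_const (0 : ℝ)).sup (hg.add (hf.integrable_comp_of_integrable ih))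

/-- The maximal ergodic inequality. -/
lemma setIntegral_birkhoffMax_pos_nonneg [IsFiniteMeasure μ] (hf : MeasurePreserving f μ μ)
    (hg : Measurable g) (hgi : Integrable g μ) (n : ℕ) :
    0 ≤ ∫ x in {x | 0 < birkhoffMax f g n x}, g x ∂μ := by
  cases n with
  | zero => simp [birkhoffMax]
  | succ n =>
    have hM := integrable_birkhoffMax hf hgi (n + 1)
    have hMT := hf.integrable_comp_of_integrable hM
    have hmeas : MeasurableSet {x | 0 < birkhoffMax f g (n + 1) x} :=
      measurableSet_lt measurable_const (measurable_birkhoffMax hf.measurable hg _)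
    have h1 : ∫ x, birkhoffMax f g (n + 1) (f x) ∂μ = ∫ x, birkhoffMax f g (n + 1) x ∂μ := by
      conv_rhs => rw [← hf.map_eq]
      rw [integral_map hf.measurable.aemeasurable]
      exact (measurable_birkhoffMax hf.measurable hg _).aestronglyMeasurable
    have h2 : ∫ x, (birkhoffMax f g (n + 1) x - birkhoffMax f g (n + 1) (f x)) ∂μ = 0 := by
      have := integral_sub hM hMT
      simp only [Function.comp] at this
      rw [this, h1, sub_self]
    rw [← integral_indicator hmeas]
    refine h2.symm.le.trans ?_
    refine integral_mono (hM.sub hMT) (hgi.indicator hmeas) fun x => ?_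
    by_cases hx : 0 < birkhoffMax f g (n + 1) x
    · rw [indicator_of_mem (by exact hx)]
      have h3 : birkhoffMax f g (n + 1) x = g x + birkhoffMax f g n (f x) := by
        rcases max_choice 0 (g x + birkhoffMax f g n (f x)) with h | h
        · exact absurd h hx.ne'
        · exact h
      have h4 := birkhoffMax_le_succ f g n (f x)
      simp only
      linarith
    · rw [indicator_of_notMem (by exact hx)]
      have h3 := birkhoffMax_nonneg f g (n + 1) (f x)
      simp only
      linarith [not_lt.1 hx]

/-- Birkhoff sums of a function with negative mean are bounded above almost surely. -/
lemma Ergodic.ae_exists_birkhoffSum_le [IsProbabilityMeasure μ] (hf : Ergodic f μ)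
    (hg : Measurable g) (hgi : Integrable g μ) (hneg : ∫ x, g x ∂μ < 0) :
    ∀ᵐ x ∂μ, ∃ C : ℝ, ∀ n, birkhoffSum f g n x ≤ C := by
  set A : Set α := {x | ∃ C : ℝ, ∀ n, birkhoffSum f g n x ≤ C} with hA
  have hmS : ∀ n, Measurable (birkhoffSum f g n) := fun n => by
    unfold birkhoffSum
    exact Finset.measurable_sum _ fun k _ => hg.comp (hf.measurable.iterate k)
  have hAeq : A = ⋃ C : ℕ, ⋂ n, {x | birkhoffSum f g n x ≤ C} := by
    ext x
    simp only [hA, mem_ofPred_eq, mem_iUnion, mem_iInter]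
    refine ⟨fun ⟨C, hC⟩ => ?_, fun ⟨C, hC⟩ => ⟨C, hC⟩⟩
    obtain ⟨m, hm⟩ := exists_nat_ge C
    exact ⟨m, fun n => (hC n).trans hm⟩
  have hAm : MeasurableSet A := by
    rw [hAeq]
    exact .iUnion fun C => .iInter fun n => measurableSet_le (hmS n) measurable_const
  have hinv : f ⁻¹' A = A := by
    ext x
    simp only [hA, mem_preimage, mem_ofPred_eq]
    constructor
    · rintro ⟨C, hC⟩
      refine ⟨max 0 (g x + C), fun n => ?_⟩
      cases n with
      | zero => simp
      | succ n => rw [birkhoffSum_succ']; exact le_max_of_le_right (by linarith [hC n])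
    · rintro ⟨C, hC⟩
      refine ⟨C - g x, fun n => ?_⟩
      have := hC (n + 1)
      rw [birkhoffSum_succ'] at this
      linarith
  rcases hf.toPreErgodic.prob_eq_zero_or_one hAm hinv with h0 | h1
  · exfalso
    have hmono : Monotone fun n => {x | 0 < birkhoffMax f g n x} :=
      monotone_nat_of_le_succ fun n x hx => lt_of_lt_of_le hx (birkhoffMax_le_succ f g n x)
    have hlim := tendsto_setIntegral_of_monotone (μ := μ) (f := g)
      (fun n => measurableSet_lt measurable_const (measurable_birkhoffMax hf.measurable hg n))
      hmono hgi.integrableOn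
    have hfull : ∫ x in ⋃ n, {x | 0 < birkhoffMax f g n x}, g x ∂μ = ∫ x, g x ∂μ := by
      rw [← setIntegral_univ (μ := μ)]
      refine setIntegral_congr_set ?_
      rw [eventuallyEq_univ]
      have : ∀ᵐ x ∂μ, x ∉ A := measure_eq_zero_iff_ae_notMem.1 h0
      filter_upwards [this] with x hx
      simp only [hA, mem_ofPred_eq, not_exists, not_forall, not_le] at hx
      obtain ⟨n, hn⟩ := hx 0
      exact mem_iUnion.2 ⟨n, hn.trans_le (birkhoffSum_le_birkhoffMax f g n x)⟩
    rw [hfull] at hlim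
    exact absurd (ge_of_tendsto' hlim fun n =>
      setIntegral_birkhoffMax_pos_nonneg hf.toMeasurePreserving hg hgi n) (not_le.2 hneg)
  · exact (mem_ae_iff_prob_eq_one hAm).2 h1

lemma Ergodic.ae_exists_birkhoffSum_le_mul_add [IsProbabilityMeasure μ] (hf : Ergodic f μ)
    (hg : Measurable g) (hgi : Integrable g μ) {c : ℝ} (hc : ∫ x, g x ∂μ < c) :
    ∀ᵐ x ∂μ, ∃ C : ℝ, ∀ n, birkhoffSum f g n x ≤ c * n + C := by
  have h := hf.ae_exists_birkhoffSum_le (g := fun x => g x - c) (hg.sub_const c)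
    (hgi.sub (integrable_const c)) (by
      rw [integral_sub hgi (integrable_const c)]; simpa using hc)
  filter_upwards [h] with x ⟨C, hC⟩
  refine ⟨C, fun n => ?_⟩
  have := hC n
  simp only [birkhoffSum, Finset.sum_sub_distrib, Finset.sum_const, Finset.card_range,
    nsmul_eq_mul] at this ⊢
  linarith

lemma Ergodic.ae_exists_mul_sub_le_birkhoffSum [IsProbabilityMeasure μ] (hf : Ergodic f μ)
    (hg : Measurable g) (hgi : Integrable g μ) {c : ℝ} (hc : c < ∫ x, g x ∂μ) :
    ∀ᵐ x ∂μ, ∃ C : ℝ, ∀ n, c * n - C ≤ birkhoffSum f g n x := by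
  have h := hf.ae_exists_birkhoffSum_le_mul_add (g := fun x => - g x) (c := -c) hg.neg hgi.neg
    (by rw [integral_neg]; linarith)
  filter_upwards [h] with x ⟨C, hC⟩
  refine ⟨C, fun n => ?_⟩
  have := hC n
  simp only [birkhoffSum, Finset.sum_neg_distrib] at this ⊢
  linarith

end MaximalErgodic

section ArrowWalk

/-- Position and local visit counts of the walk which, at its `i`-th visit to `z`
(counted from `0`), follows the arrow `a z i` (`true` is a step to the right). -/
def arrowState (a : ℤ → ℕ → Bool) : ℕ → ℤ × (ℤ → ℕ)
  | 0 => (0, fun _ => 0)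
  | t + 1 => ((arrowState a t).1 +
        (if a (arrowState a t).1 ((arrowState a t).2 (arrowState a t).1) then 1 else -1),
      Function.update (arrowState a t).2 (arrowState a t).1
        ((arrowState a t).2 (arrowState a t).1 + 1))

/-- The walk started at `0` which follows the arrows `a`. -/
def arrowWalk (a : ℤ → ℕ → Bool) (t : ℕ) : ℤ := (arrowState a t).1

/-- The number of visits of `Y` to `z` at times `< t`. -/
def visits (Y : ℕ → ℤ) (z : ℤ) (t : ℕ) : ℕ := Nat.count (fun s => Y s = z) t

/-- The number of jumps of `Y` from `z` to `z - 1` at times `< t`. -/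
def downs (Y : ℕ → ℤ) (z : ℤ) (t : ℕ) : ℕ := Nat.count (fun s => Y s = z ∧ Y (s + 1) = z - 1) t

/-- The number of jumps of `Y` from `z` to `z + 1` at times `< t`. -/
def ups (Y : ℕ → ℤ) (z : ℤ) (t : ℕ) : ℕ := Nat.count (fun s => Y s = z ∧ Y (s + 1) = z + 1) t

/-- `Y` starts at `0` and makes steps `±1`. -/
structure IsNNPath (Y : ℕ → ℤ) : Prop where
  zero : Y 0 = 0
  step : ∀ t, Y (t + 1) = Y t + 1 ∨ Y (t + 1) = Y t - 1

lemma visits_succ (Y : ℕ → ℤ) (z : ℤ) (t : ℕ) :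
    visits Y z (t + 1) = visits Y z t + if Y t = z then 1 else 0 := Nat.count_succ _ _

lemma downs_succ (Y : ℕ → ℤ) (z : ℤ) (t : ℕ) :
    downs Y z (t + 1) = downs Y z t + if Y t = z ∧ Y (t + 1) = z - 1 then 1 else 0 :=
  Nat.count_succ _ _

lemma ups_succ (Y : ℕ → ℤ) (z : ℤ) (t : ℕ) :
    ups Y z (t + 1) = ups Y z t + if Y t = z ∧ Y (t + 1) = z + 1 then 1 else 0 :=
  Nat.count_succ _ _

lemma prevVisits_eq_visits (Y : ℕ → ℤ) (t : ℕ) : prevVisits Y t = visits Y (Y t) t := by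
  rw [prevVisits, visits, Nat.count_eq_card_filter_range]

lemma arrowState_snd (a : ℤ → ℕ → Bool) (t : ℕ) (z : ℤ) :
    (arrowState a t).2 z = visits (arrowWalk a) z t := by
  induction t with
  | zero => simp [arrowState, visits]
  | succ t ih =>
    rw [visits_succ, ← ih, arrowState, arrowWalk]
    by_cases h : z = (arrowState a t).1
    · subst h; simp
    · simp [Function.update_of_ne h, Ne.symm h]

lemma arrowWalk_zero (a : ℤ → ℕ → Bool) : arrowWalk a 0 = 0 := rfl

lemma arrowWalk_succ (a : ℤ → ℕ → Bool) (t : ℕ) :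
    arrowWalk a (t + 1) = arrowWalk a t +
      if a (arrowWalk a t) (visits (arrowWalk a) (arrowWalk a t) t) then 1 else -1 := by
  rw [← arrowState_snd]; rfl

lemma isNNPath_arrowWalk (a : ℤ → ℕ → Bool) : IsNNPath (arrowWalk a) := by
  refine ⟨rfl, fun t => ?_⟩
  rw [arrowWalk_succ]
  split_ifs
  · exact .inl rfl
  · exact .inr rfl

namespace IsNNPath

variable {Y : ℕ → ℤ}

lemma visits_eq_ups_add_downs (hY : IsNNPath Y) (z : ℤ) (t : ℕ) :
    visits Y z t = ups Y z t + downs Y z t := by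
  induction t with
  | zero => simp [visits, ups, downs]
  | succ t ih =>
    rw [visits_succ, ups_succ, downs_succ, ih]
    rcases hY.step t with h | h <;> split_ifs <;> omega

lemma ups_eq_downs_add (hY : IsNNPath Y) {z : ℤ} (hz : 0 ≤ z) (t : ℕ) :
    ups Y z t = downs Y (z + 1) t + if z < Y t then 1 else 0 := by
  induction t with
  | zero => simp [ups, downs, hY.zero, hz]
  | succ t ih =>
    rw [ups_succ, downs_succ, ih]
    rcases hY.step t with h | h <;> split_ifs <;> omega

lemma lt_of_forall_ne (hY : IsNNPath Y) {n : ℤ} (hn : 0 ≤ n) {t : ℕ}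
    (h : ∀ s < t, Y s ≠ n) : ∀ s < t, Y s < n := by
  intro s
  induction s with
  | zero => intro hs; have := h 0 hs; have := hY.zero; omega
  | succ s ih =>
    intro hs
    have h1 := ih (by omega)
    have h2 := h _ hs
    rcases hY.step s with h | h <;> omega

lemma abs_sub_le (hY : IsNNPath Y) (t s : ℕ) :
    Y t - s ≤ Y (t + s) ∧ Y (t + s) ≤ Y t + s := by
  induction s with
  | zero => simp
  | succ s ih =>
    rw [← add_assoc]
    push_cast
    rcases hY.step (t + s) with h | h <;> omega

end IsNNPath

lemma ups_arrowWalk (a : ℤ → ℕ → Bool) (z : ℤ) (t : ℕ) :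
    ups (arrowWalk a) z t = Nat.count (fun i => a z i = true) (visits (arrowWalk a) z t) := by
  induction t with
  | zero => simp [visits, ups]
  | succ t ih =>
    rw [visits_succ, ups_succ, ih, arrowWalk_succ]
    by_cases h : arrowWalk a t = z
    · subst h
      simp only [true_and, if_true, Nat.count_succ]
      congr 1
      split_ifs <;> omega
    · simp [h]

lemma last_arrow_of_lt (a : ℤ → ℕ → Bool) {z : ℤ} (hz : 0 ≤ z) (t : ℕ)
    (h : z < arrowWalk a t) :
    ∃ v, visits (arrowWalk a) z t = v + 1 ∧ a z v = true := by
  induction t with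
  | zero => rw [arrowWalk_zero] at h; omega
  | succ t ih =>
    rw [visits_succ]
    by_cases hzt : z < arrowWalk a t
    · obtain ⟨v, hv, hav⟩ := ih hzt
      exact ⟨v, by rw [if_neg hzt.ne', hv], hav⟩
    · rw [arrowWalk_succ] at h
      have hcase : arrowWalk a t = z := by split_ifs at h <;> omega
      rw [hcase] at h
      refine ⟨visits (arrowWalk a) z t, by rw [if_pos hcase], ?_⟩
      by_contra hn
      rw [if_neg hn] at h
      omega

/-- The index of the right arrow in the stack `s` preceded by exactly `d` right arrows. -/
def rightIndex (s : ℕ → Bool) (d : ℕ) : ℕ :=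
  sInf {m | s m = true ∧ Nat.count (fun i => s i = true) m = d}

lemma rightIndex_eq {s : ℕ → Bool} {d m : ℕ} (h : s m = true)
    (hd : Nat.count (fun i => s i = true) m = d) : rightIndex s d = m := by
  have : {m | s m = true ∧ Nat.count (fun i => s i = true) m = d} = {m} := by
    ext k
    simp only [mem_ofPred_eq, mem_singleton_iff]
    refine ⟨fun ⟨h1, h2⟩ => ?_, fun hk => hk ▸ ⟨h, hd⟩⟩
    exact Nat.count_injective (p := fun i => s i = true) h1 h (h2.trans hd.symm)
  rw [rightIndex, this, csInf_singleton]

/-- The number of jumps from `0` to `-1` before first reaching `J`, in terms of the stacks of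
arrows at the sites `0, 1, …`. -/
def stackDowns : ℕ → (ℕ → ℕ → Bool) → ℕ
  | 0, _ => 0
  | J + 1, b => rightIndex (b 0) (stackDowns J (shiftSeq b)) - stackDowns J (shiftSeq b)

/-- The number of visits to `0` before first reaching `J`, in terms of the stacks of
arrows at the sites `0, 1, …`. -/
def stackVisits : ℕ → (ℕ → ℕ → Bool) → ℕ
  | 0, _ => 0
  | J + 1, b => rightIndex (b 0) (stackDowns J (shiftSeq b)) + 1

/-- The stacks of arrows at the sites `x, x + 1, …`. -/
def stacksFrom (a : ℤ → ℕ → Bool) (x : ℕ) : ℕ → ℕ → Bool := fun z => a ((x + z : ℕ) : ℤ)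

lemma shiftSeq_stacksFrom (a : ℤ → ℕ → Bool) (x : ℕ) :
    shiftSeq (stacksFrom a x) = stacksFrom a (x + 1) := by
  funext z
  simp only [shiftSeq, stacksFrom]
  congr 2
  omega

lemma iterate_shiftSeq_stacksFrom (a : ℤ → ℕ → Bool) (x k : ℕ) :
    shiftSeq^[k] (stacksFrom a x) = stacksFrom a (x + k) := by
  induction k with
  | zero => rfl
  | succ k ih => rw [Function.iterate_succ_apply', ih, shiftSeq_stacksFrom, add_assoc]

/-- Before the first passage time of `x + J`, the walk's downward jumps from `x` and visits to `x`
are determined by the stacks at `x, x + 1, …`. -/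
lemma downs_visits_arrowWalk (a : ℤ → ℕ → Bool) {n : ℕ} {t : ℕ} (ht : arrowWalk a t = n)
    (hlt : ∀ s < t, arrowWalk a s < n) (J x : ℕ) (hx : x + J = n) :
    downs (arrowWalk a) x t = stackDowns J (stacksFrom a x) ∧
      visits (arrowWalk a) x t = stackVisits J (stacksFrom a x) := by
  induction J generalizing x with
  | zero =>
    simp only [add_zero] at hx
    subst hx
    simp only [stackDowns, stackVisits, downs, visits, Nat.count_iff_forall_not]
    exact ⟨fun s hs h => (hlt s hs).ne h.1, fun s hs => (hlt s hs).ne⟩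
  | succ J ih =>
    have ih := (ih (x + 1) (by omega)).1
    have hY := isNNPath_arrowWalk a
    have hxt : (x : ℤ) < arrowWalk a t := by rw [ht]; omega
    have h1 := hY.ups_eq_downs_add (z := x) (by omega) t
    rw [if_pos hxt] at h1
    push_cast at ih
    rw [ih] at h1
    obtain ⟨v, hv, hav⟩ := last_arrow_of_lt a (by omega) t hxt
    have h2 := ups_arrowWalk a x t
    rw [hv, Nat.count_succ, if_pos hav] at h2
    have h3 := hY.visits_eq_ups_add_downs x t
    have h4 : rightIndex (stacksFrom a x 0) (stackDowns J (stacksFrom a (x + 1))) = v :=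
      rightIndex_eq (s := stacksFrom a x 0) (by simpa [stacksFrom] using hav)
        (by simp only [stacksFrom, add_zero] at h1 ⊢; omega)
    rw [stackDowns, stackVisits, shiftSeq_stacksFrom, h4]
    omega

end ArrowWalk

section HittingTime

variable {Y : ℕ → ℤ}

/-- The first passage time of `n`, with value `0` if `n` is never visited. -/
def hitTime (Y : ℕ → ℤ) (n : ℤ) : ℕ := sInf {t | Y t = n}

/-- A nearest-neighbour path from `0` which visits every positive site. -/
structure IsUnboundedPath (Y : ℕ → ℤ) : Prop extends IsNNPath Y where
  exists_eq : ∀ n : ℕ, ∃ t, Y t = n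

namespace IsUnboundedPath

lemma apply_hitTime (hY : IsUnboundedPath Y) (n : ℕ) : Y (hitTime Y n) = n :=
  Nat.sInf_mem (s := {t | Y t = n}) (hY.exists_eq n)

lemma ne_of_lt_hitTime {n : ℤ} {s : ℕ} (hs : s < hitTime Y n) : Y s ≠ n :=
  Nat.notMem_of_lt_sInf (s := {t | Y t = n}) hs

lemma lt_of_lt_hitTime (hY : IsUnboundedPath Y) {n s : ℕ} (hs : s < hitTime Y n) : Y s < n :=
  hY.toIsNNPath.lt_of_forall_ne (by omega) (fun _ => ne_of_lt_hitTime) s hs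

lemma hitTime_lt_succ (hY : IsUnboundedPath Y) (n : ℕ) :
    hitTime Y n < hitTime Y (n + 1 : ℕ) := by
  by_contra! h
  rcases h.lt_or_eq with h | h
  · have := hY.lt_of_lt_hitTime h
    rw [hY.apply_hitTime] at this
    omega
  · have h1 := hY.apply_hitTime n
    rw [← h, hY.apply_hitTime] at h1
    omega

lemma hitTime_strictMono (hY : IsUnboundedPath Y) : StrictMono fun n : ℕ => hitTime Y n :=
  strictMono_nat_of_lt_succ hY.hitTime_lt_succ

lemma T_eq_hitTime (hY : IsUnboundedPath Y) (n : ℕ) : T n Y = hitTime Y n := by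
  apply le_antisymm
  · exact sInf_le ⟨_, rfl, hY.apply_hitTime n⟩
  · refine le_sInf ?_
    rintro _ ⟨s, rfl, hs⟩
    exact_mod_cast Nat.sInf_le (s := {t | Y t = n}) hs

end IsUnboundedPath

lemma sum_count_eq_count_exists (Y : ℕ → ℤ) (c : ℕ → ℤ) (j t : ℕ)
    (hc : ∀ i < j, ∀ i' < j, c i = c i' → i = i') :
    ∑ i ∈ Finset.range j, Nat.count (fun s => Y s = c i) t =
      Nat.count (fun s => ∃ i < j, Y s = c i) t := by
  induction t with
  | zero => simp
  | succ t ih =>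
    simp only [Nat.count_succ, Finset.sum_add_distrib, ih]
    congr 1
    split_ifs with h
    · obtain ⟨i, hi, hY⟩ := h
      rw [Finset.sum_eq_single i]
      · rw [if_pos hY]
      · intro i' hi' hne
        rw [if_neg fun h => hne (hc i' (Finset.mem_range.1 hi') i hi (h.symm.trans hY))]
      · exact fun h => absurd (Finset.mem_range.2 hi) h
    · exact Finset.sum_eq_zero fun i hi => if_neg fun h' => h ⟨i, Finset.mem_range.1 hi, h'⟩

lemma visits_hitTime {a : ℤ → ℕ → Bool} (ha : IsUnboundedPath (arrowWalk a)) (x J : ℕ) :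
    visits (arrowWalk a) x (hitTime (arrowWalk a) (x + J : ℕ)) =
      stackVisits J (stacksFrom a x) :=
  (downs_visits_arrowWalk a (ha.apply_hitTime _) (fun _ => ha.lt_of_lt_hitTime) J x rfl).2

lemma stackVisits_mono {a : ℤ → ℕ → Bool} (ha : IsUnboundedPath (arrowWalk a)) (x : ℕ) :
    Monotone fun J => stackVisits J (stacksFrom a x) := by
  intro J J' h
  simp only [← visits_hitTime ha]
  exact Nat.count_monotone _ (ha.hitTime_strictMono.monotone (by omega))

/-- The passage time of `n` is the time spent at `0, …, n - 1` plus the time spent below `0`. -/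
lemma hitTime_eq_sum {a : ℤ → ℕ → Bool} (ha : IsUnboundedPath (arrowWalk a)) (n : ℕ) :
    hitTime (arrowWalk a) n = ∑ x ∈ Finset.range n, stackVisits (n - x) (stacksFrom a x) +
      Nat.count (fun s => arrowWalk a s < 0) (hitTime (arrowWalk a) n) := by
  have h1 : ∑ x ∈ Finset.range n, stackVisits (n - x) (stacksFrom a x) =
      ∑ x ∈ Finset.range n,
        Nat.count (fun s => arrowWalk a s = (x : ℤ)) (hitTime (arrowWalk a) n) := by
    refine Finset.sum_congr rfl fun x hx => ?_
    rw [← visits_hitTime ha, visits, Nat.add_sub_cancel' (Finset.mem_range.1 hx).le]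
  rw [h1, sum_count_eq_count_exists _ (fun i => (i : ℤ)) n _ (fun i _ i' _ h => by
    exact_mod_cast h)]
  have key : ∀ t ≤ hitTime (arrowWalk a) n,
      t = Nat.count (fun s => ∃ i < n, arrowWalk a s = (i : ℤ)) t +
        Nat.count (fun s => arrowWalk a s < 0) t := by
    intro t ht
    induction t with
    | zero => simp
    | succ t ih =>
      have h2 := ih (by omega)
      have h3 := ha.lt_of_lt_hitTime (show t < hitTime (arrowWalk a) n by omega)
      rw [Nat.count_succ, Nat.count_succ]
      by_cases h4 : arrowWalk a t < 0
      · rw [if_pos h4, if_neg]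
        · omega
        · rintro ⟨i, _, hi⟩; omega
      · rw [if_neg h4, if_pos ⟨(arrowWalk a t).toNat, by omega, by omega⟩]
        omega
  exact key _ le_rfl

/-- The time between the passages of `j - 1` and `j` spent at `0, …, j - 1`, in terms of the
stacks of arrows at `0, 1, …`. -/
def stackTime (j : ℕ) (b : ℕ → ℕ → Bool) : ℕ :=
  ∑ i ∈ Finset.range j, (stackVisits (i + 1) (shiftSeq^[j - 1 - i] b) -
    stackVisits i (shiftSeq^[j - 1 - i] b))

lemma stackTime_eq_count {a : ℤ → ℕ → Bool} (ha : IsUnboundedPath (arrowWalk a)) {j k : ℕ}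
    (hjk : j ≤ k + 1) :
    stackTime j (stacksFrom a (k + 1 - j)) =
      Nat.count (fun s => ∃ i < j, arrowWalk a (hitTime (arrowWalk a) k + s) = (k : ℤ) - i)
        (hitTime (arrowWalk a) (k + 1 : ℕ) - hitTime (arrowWalk a) k) := by
  rw [← sum_count_eq_count_exists (fun s => arrowWalk a (hitTime (arrowWalk a) k + s))
    (fun i => (k : ℤ) - i) j _ (fun i _ i' _ h => by omega), stackTime]
  refine Finset.sum_congr rfl fun i hi => ?_
  have hi := Finset.mem_range.1 hi
  rw [iterate_shiftSeq_stacksFrom, show k + 1 - j + (j - 1 - i) = k - i by omega,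
    ← visits_hitTime ha, ← visits_hitTime ha, show k - i + (i + 1) = k + 1 by omega,
    show k - i + i = k by omega, visits, visits]
  have := ha.hitTime_lt_succ k
  conv_lhs => rw [show hitTime (arrowWalk a) (k + 1 : ℕ) = hitTime (arrowWalk a) k +
    (hitTime (arrowWalk a) (k + 1 : ℕ) - hitTime (arrowWalk a) k) by omega]
  rw [Nat.count_add, Nat.add_sub_cancel_left]
  have : ((k - i : ℕ) : ℤ) = (k : ℤ) - i := by omega
  rw [this]

lemma stackTime_mono {a : ℤ → ℕ → Bool} (ha : IsUnboundedPath (arrowWalk a)) {j J k : ℕ}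
    (hjJ : j ≤ J) (hJk : J ≤ k + 1) :
    stackTime j (stacksFrom a (k + 1 - j)) ≤ stackTime J (stacksFrom a (k + 1 - J)) := by
  rw [stackTime_eq_count ha hJk, stackTime_eq_count ha (hjJ.trans hJk)]
  exact Nat.count_mono_left fun s _ ⟨i, hi, h⟩ => ⟨i, hi.trans_le hjJ, h⟩

/-- A passage from `k` to `k + 1` takes at least `j` steps if and only if it spends at least `j`
steps at the sites `k - j + 1, …, k`. -/
lemma le_stackTime_iff {a : ℤ → ℕ → Bool} (ha : IsUnboundedPath (arrowWalk a)) {j k : ℕ}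
    (hjk : j ≤ k + 1) :
    j ≤ stackTime j (stacksFrom a (k + 1 - j)) ↔
      hitTime (arrowWalk a) k + j ≤ hitTime (arrowWalk a) (k + 1 : ℕ) := by
  have hlt := ha.hitTime_lt_succ k
  rw [stackTime_eq_count ha hjk]
  constructor
  · intro h
    have := h.trans (Nat.count_le _)
    omega
  · intro h
    refine le_trans ?_ (Nat.count_monotone _ (show j ≤ _ by omega))
    refine (Nat.count_iff_forall.2 fun s hs => ?_).ge
    have h1 := ha.toIsNNPath.abs_sub_le (hitTime (arrowWalk a) k) s
    have h2 := ha.lt_of_lt_hitTime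
      (show hitTime (arrowWalk a) k + s < hitTime (arrowWalk a) (k + 1 : ℕ) by omega)
    rw [ha.apply_hitTime] at h1
    exact ⟨((k : ℤ) - arrowWalk a (hitTime (arrowWalk a) k + s)).toNat, by omega, by omega⟩

end HittingTime

section BernoulliShift

variable {E F : Type*} [MeasurableSpace E] [MeasurableSpace F]

lemma measurable_shiftSeq : Measurable (shiftSeq : (ℕ → E) → ℕ → E) :=
  measurable_pi_lambda _ fun n => measurable_pi_apply (n + 1)

lemma iterate_shiftSeq_apply {E : Type*} (u : ℕ → E) (n i : ℕ) :
    shiftSeq^[n] u i = u (i + n) := by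
  induction n generalizing u with
  | zero => rfl
  | succ n ih => rw [Function.iterate_succ_apply, ih]; simp only [shiftSeq]; congr 1

lemma measurePreserving_shiftSeq_infinitePi (P : Measure E) [IsProbabilityMeasure P] :
    MeasurePreserving shiftSeq (Measure.infinitePi fun _ : ℕ => P)
      (Measure.infinitePi fun _ : ℕ => P) :=
  ⟨measurable_shiftSeq, Measure.map_infinitePi_infinitePi_of_inj (P := fun _ : ℕ => P)
    (f := fun n => n + 1) (add_left_injective 1)⟩

/-- Kolmogorov's zero-one law in the form: a set which for every `n` only depends on the sequence
shifted by `n` is trivial. -/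
lemma infinitePi_zero_or_one_of_forall_shift (P : Measure E) [IsProbabilityMeasure P]
    {t : Set (ℕ → E)} (ht : ∀ n, ∃ t' : Set (ℕ → E), MeasurableSet t' ∧ t = shiftSeq^[n] ⁻¹' t') :
    Measure.infinitePi (fun _ : ℕ => P) t = 0 ∨ Measure.infinitePi (fun _ : ℕ => P) t = 1 := by
  have hind : iIndepFun (fun (i : ℕ) (u : ℕ → E) => u i) (Measure.infinitePi fun _ : ℕ => P) :=
    iIndepFun_infinitePi (X := fun _ (x : E) => x) fun _ => measurable_id
  refine measure_zero_or_one_of_measurableSet_limsup_atTop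
    (fun n => (measurable_pi_apply n).comap_le) hind.iIndep ?_
  rw [limsup_eq_iInf_iSup_of_nat, MeasurableSpace.measurableSet_iInf]
  intro n
  obtain ⟨t', ht', rfl⟩ := ht n
  refine @measurableSet_preimage _ _ (_) _ _ _ ?_ ht'
  refine @measurable_pi_lambda _ _ _ (_) _ _ fun i => ?_
  have h1 : (fun u : ℕ → E => shiftSeq^[n] u i) = fun u => u (i + n) := by
    funext u; exact iterate_shiftSeq_apply u n i
  rw [h1]
  refine Measurable.mono (comap_measurable fun u : ℕ → E => u (i + n)) ?_ le_rfl
  exact le_iSup₂_of_le (i + n) (Nat.le_add_left n i) le_rfl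

/-- The product of an ergodic shift and a Bernoulli shift is ergodic. -/
lemma Ergodic.prod_infinitePi {π : Measure (ℕ → F)} [IsProbabilityMeasure π]
    (hπ : Ergodic shiftSeq π) (P : Measure E) [IsProbabilityMeasure P] :
    Ergodic (Prod.map shiftSeq shiftSeq) (π.prod (Measure.infinitePi fun _ : ℕ => P)) := by
  have hmp := hπ.toMeasurePreserving.prod (measurePreserving_shiftSeq_infinitePi P)
  refine ⟨hmp, ⟨fun s hs hinv => ?_⟩⟩
  set Λ := Measure.infinitePi fun _ : ℕ => P
  have hit : ∀ n w u, (w, u) ∈ s ↔ (shiftSeq^[n] w, shiftSeq^[n] u) ∈ s := by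
    intro n
    induction n with
    | zero => intro w u; rfl
    | succ n ih =>
      intro w u
      rw [Function.iterate_succ_apply, Function.iterate_succ_apply, ← ih]
      nth_rewrite 1 [← hinv]
      rfl
  have h01 : ∀ w, Λ (Prod.mk w ⁻¹' s) = 0 ∨ Λ (Prod.mk w ⁻¹' s) = 1 := by
    intro w
    refine infinitePi_zero_or_one_of_forall_shift P fun n =>
      ⟨Prod.mk (shiftSeq^[n] w) ⁻¹' s, measurable_prodMk_left hs, ?_⟩
    ext u
    exact hit n w u
  have hmeas : Measurable fun w => Λ (Prod.mk w ⁻¹' s) := measurable_measure_prodMk_left hs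
  have hAm : MeasurableSet {w | Λ (Prod.mk w ⁻¹' s) = 1} := hmeas (measurableSet_singleton 1)
  have hAinv : shiftSeq ⁻¹' {w | Λ (Prod.mk w ⁻¹' s) = 1} = {w | Λ (Prod.mk w ⁻¹' s) = 1} := by
    ext w
    simp only [mem_preimage, mem_ofPred_eq]
    have : Λ (Prod.mk w ⁻¹' s) = Λ (Prod.mk (shiftSeq w) ⁻¹' s) := by
      rw [← (measurePreserving_shiftSeq_infinitePi P).measure_preimage
        (s := Prod.mk (shiftSeq w) ⁻¹' s) (measurable_prodMk_left hs).nullMeasurableSet]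
      congr 1
      ext u
      exact hit 1 w u
    rw [this]
  rw [eventuallyConst_set']
  rcases hπ.toPreErgodic.ae_mem_or_ae_notMem hAm hAinv with h | h
  · right
    rw [eventuallyEq_univ]
    refine (mem_ae_iff_prob_eq_one hs).2 ?_
    rw [Measure.prod_apply hs, lintegral_congr_ae (g := fun _ => 1) h]
    simp
  · left
    rw [ae_eq_empty, Measure.measure_prod_null hs]
    filter_upwards [h] with w hw
    exact (h01 w).resolve_right hw

end BernoulliShift

section ArrowLaw

/-- The uniform distribution on `[0, 1]`. -/
def unif : Measure ℝ := volume.restrict (Icc 0 1)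

instance : IsProbabilityMeasure unif := ⟨by simp [unif]⟩

lemma unif_Iic {p : ℝ} (hp : p ∈ Icc (0 : ℝ) 1) : unif (Iic p) = ENNReal.ofReal p := by
  have : Iic p ∩ Icc 0 1 = Icc 0 p := by
    ext x
    simp only [mem_inter_iff, mem_Iic, mem_Icc]
    exact ⟨fun h => ⟨h.2.1, h.1⟩, fun h => ⟨h.2, h.1, h.2.trans hp.2⟩⟩
  rw [unif, Measure.restrict_apply measurableSet_Iic, this, Real.volume_Icc, sub_zero]

lemma unif_Ioi {p : ℝ} (hp : p ∈ Icc (0 : ℝ) 1) : unif (Ioi p) = ENNReal.ofReal (1 - p) := by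
  have : Ioi p ∩ Icc 0 1 = Ioc p 1 := by
    ext x
    simp only [mem_inter_iff, mem_Ioi, mem_Icc, mem_Ioc]
    exact ⟨fun h => ⟨h.1, h.2.2⟩, fun h => ⟨h.1, hp.1.trans h.1.le, h.2⟩⟩
  rw [unif, Measure.restrict_apply measurableSet_Ioi, this, Real.volume_Ioc]

/-- Independent uniform random variables for the stacks at the sites in `ι`. -/
def unifStacks (ι : Type*) : Measure (ι → ℕ → ℝ) :=
  Measure.infinitePi fun _ : ι => Measure.infinitePi fun _ : ℕ => unif

instance (ι : Type*) : IsProbabilityMeasure (unifStacks ι) := by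
  unfold unifStacks; infer_instance

/-- The arrows obtained by comparing cookie strengths with uniform random variables. -/
def arrows {ι : Type*} (q : (ι → ℕ → ℝ) × (ι → ℕ → ℝ)) : ι → ℕ → Bool :=
  fun z i => decide (q.2 z i ≤ q.1 z i)

lemma measurable_arrows {ι : Type*} : Measurable (arrows (ι := ι)) := by
  refine measurable_pi_lambda _ fun z => measurable_pi_lambda _ fun i => ?_
  refine measurable_to_bool ?_
  have : (fun q : (ι → ℕ → ℝ) × (ι → ℕ → ℝ) => arrows q z i) ⁻¹' {true} =
      {q | q.2 z i ≤ q.1 z i} := by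
    ext q; simp [arrows]
  rw [this]
  exact measurableSet_le (by fun_prop) (by fun_prop)

lemma unifStacks_forall_mem {ι : Type*} {n : ℕ} {c : Fin n → ι × ℕ} (hc : Function.Injective c)
    {B : Fin n → Set ℝ} (hB : ∀ m, MeasurableSet (B m)) :
    unifStacks ι {U | ∀ m, U (c m).1 (c m).2 ∈ B m} = ∏ m, unif (B m) := by
  have h1 : unifStacks ι = (Measure.infinitePi fun _ : ι × ℕ => unif).map
      (MeasurableEquiv.curry ι ℕ ℝ) :=
    (Measure.infinitePi_map_curry (fun (_ : ι) (_ : ℕ) => unif)).symm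
  have h2 := Measure.map_infinitePi_infinitePi_of_inj (P := fun _ : ι × ℕ => unif) hc
  have h3 : MeasurableSet (Set.pi univ B) := MeasurableSet.univ_pi hB
  have h4 : MeasurableSet {U : ι → ℕ → ℝ | ∀ m, U (c m).1 (c m).2 ∈ B m} := by
    simp only [ofPred_forall]
    refine MeasurableSet.iInter fun m => ?_
    have : Measurable fun U : ι → ℕ → ℝ => U (c m).1 (c m).2 := by fun_prop
    exact this (hB m)
  rw [h1, Measure.map_apply (MeasurableEquiv.measurable _) h4]
  have h5 : (Measure.infinitePi fun _ : Fin n => unif) (Set.pi univ B) = ∏ m, unif (B m) := by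
    rw [Measure.infinitePi_eq_pi, Measure.pi_pi]
  rw [← h5, ← h2, Measure.map_apply (by fun_prop) h3]
  congr 1
  ext U
  simp [MeasurableEquiv.curry, Function.curry]

lemma visits_congr {x y : ℕ → ℤ} {n : ℕ} (h : ∀ m < n, x m = y m) (z : ℤ) :
    visits x z n = visits y z n := by
  simp only [visits, Nat.count_eq_card_filter_range]
  congr 1
  refine Finset.filter_congr fun m hm => ?_
  rw [h m (Finset.mem_range.1 hm)]

lemma arrowWalk_eq_iff {a : ℤ → ℕ → Bool} {x : ℕ → ℤ} (hx0 : x 0 = 0) {n : ℕ}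
    (hx : ∀ m < n, x (m + 1) = x m + 1 ∨ x (m + 1) = x m - 1) :
    (∀ m ≤ n, arrowWalk a m = x m) ↔
      ∀ m < n, (a (x m) (prevVisits x m) = true ↔ x (m + 1) = x m + 1) := by
  simp only [prevVisits_eq_visits]
  constructor
  · intro h m hm
    have h1 := arrowWalk_succ a m
    rw [visits_congr (y := x) (fun k hk => h k (by omega)), h m hm.le, h (m + 1) hm] at h1
    split_ifs at h1 with h2 <;> simp [h2] <;> omega
  · intro h m
    induction m using Nat.strong_induction_on with
    | _ m ih =>
      intro hm
      cases m with
      | zero => rw [hx0, arrowWalk_zero]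
      | succ m =>
        rw [arrowWalk_succ, visits_congr (y := x) (fun k hk => ih k (by omega) (by omega)),
          ih m (by omega) (by omega)]
        have h1 := h m hm
        rcases hx m hm with h2 | h2
        · rw [if_pos (h1.2 h2), h2]
        · rw [if_neg (fun h3 => by have := h1.1 h3; omega), h2]; rfl

lemma prevVisits_injOn (x : ℕ → ℤ) : Function.Injective fun m => (x m, prevVisits x m) := by
  have key : ∀ m k, m < k → x m = x k → prevVisits x m < prevVisits x k := by
    intro m k hmk h
    rw [prevVisits_eq_visits, prevVisits_eq_visits, h]
    exact Nat.count_strict_mono h hmk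
  intro m k h
  simp only [Prod.mk.injEq] at h
  rcases lt_trichotomy m k with h1 | h1 | h1
  · exact absurd (key m k h1 h.1) (by omega)
  · exact h1
  · exact absurd (key k m h1 h.1.symm) (by omega)

lemma measurable_arrowWalk : Measurable arrowWalk := by
  have hstep : ∀ t, (Measurable fun a : ℤ → ℕ → Bool => (arrowState a t).1) ∧
      ∀ z, Measurable fun a : ℤ → ℕ → Bool => (arrowState a t).2 z := by
    intro t
    induction t with
    | zero => exact ⟨measurable_const, fun z => measurable_const⟩
    | succ t ih =>
      have hloc : Measurable fun a : ℤ → ℕ → Bool => (arrowState a t).2 (arrowState a t).1 :=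
        (measurable_from_prod_countable_right (f := fun p : ℤ × (ℤ → ℕ → Bool) =>
          (arrowState p.2 t).2 p.1) ih.2).comp (ih.1.prodMk measurable_id)
      have harr : Measurable fun a : ℤ → ℕ → Bool =>
          a (arrowState a t).1 ((arrowState a t).2 (arrowState a t).1) :=
        (measurable_from_prod_countable_right (f := fun p : (ℤ × ℕ) × (ℤ → ℕ → Bool) =>
          p.2 p.1.1 p.1.2) fun p =>
            (measurable_pi_apply p.2).comp (measurable_pi_apply p.1)).comp
            ((ih.1.prodMk hloc).prodMk measurable_id)
      refine ⟨ih.1.add (Measurable.ite (harr (measurableSet_singleton true))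
        measurable_const measurable_const), fun z => ?_⟩
      simp only [arrowState, Function.update_apply]
      exact Measurable.ite (measurableSet_eq_fun measurable_const ih.1)
        (hloc.add_const 1) (ih.2 z)
  exact measurable_pi_lambda _ fun t => (hstep t).1

/-- The walk following the arrows built from `ω` is a multi-excited random walk in `ω`. -/
lemma isERWLaw_arrowWalk {ω : CEnv} (hω : IsCookieEnv ω) :
    IsERWLaw ω 0 ((unifStacks ℤ).map fun U => arrowWalk (arrows (ω, U))) := by
  have hm : Measurable fun U => arrowWalk (arrows (ω, U)) :=
    measurable_arrowWalk.comp (measurable_arrows.comp measurable_prodMk_left)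
  refine ⟨Measure.isProbabilityMeasure_map hm.aemeasurable, fun x n => ?_⟩
  have hcyl : MeasurableSet {Y : ℕ → ℤ | ∀ m ≤ n, Y m = x m} := by
    simp only [ofPred_forall]
    exact .iInter fun m => .iInter fun _ => measurableSet_eq_fun (measurable_pi_apply m) measurable_const
  rw [Measure.map_apply hm hcyl]
  have hIcc : ∀ z i, ω z i ∈ Icc (0 : ℝ) 1 := fun z i =>
    ⟨by linarith [(hω z i).1], (hω z i).2⟩
  by_cases hx0 : x 0 = 0
  swap
  · rw [cylProb, if_neg hx0, zero_mul, ENNReal.ofReal_zero]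
    convert measure_empty (μ := unifStacks ℤ)
    ext U
    simp only [mem_preimage, mem_ofPred_eq, mem_empty_iff_false, iff_false]
    exact fun h => hx0 (h 0 (Nat.zero_le n)).symm
  by_cases hx : ∀ m < n, x (m + 1) = x m + 1 ∨ x (m + 1) = x m - 1
  swap
  · push Not at hx
    obtain ⟨m, hmn, h1, h2⟩ := hx
    rw [cylProb, Finset.prod_eq_zero (Finset.mem_range.2 hmn), mul_zero, ENNReal.ofReal_zero]
    · convert measure_empty (μ := unifStacks ℤ)
      ext U
      simp only [mem_preimage, mem_ofPred_eq, mem_empty_iff_false, iff_false]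
      intro h
      have := (isNNPath_arrowWalk (arrows (ω, U))).step m
      rw [h m hmn.le, h (m + 1) hmn] at this
      exact this.elim h1 h2
    · rw [stepProb, if_neg h1, if_neg h2]
  have hset : (fun U => arrowWalk (arrows (ω, U))) ⁻¹' {Y | ∀ m ≤ n, Y m = x m} =
      {U | ∀ m : Fin n, U (x m) (prevVisits x m) ∈
        if x (m + 1) = x m + 1 then Iic (ω (x m) (prevVisits x m))
          else Ioi (ω (x m) (prevVisits x m))} := by
    ext U
    simp only [mem_preimage, mem_ofPred_eq]
    rw [arrowWalk_eq_iff hx0 hx, Fin.forall_iff]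
    refine forall₂_congr fun m hm => ?_
    simp only [arrows, decide_eq_true_eq]
    split_ifs with h <;> simp [h]
  rw [hset, unifStacks_forall_mem (c := fun m : Fin n => (x m, prevVisits x m))
    ((prevVisits_injOn x).comp Fin.val_injective) (fun m => by split_ifs <;> measurability),
    cylProb, if_pos hx0, one_mul, ENNReal.ofReal_prod_of_nonneg, ← Fin.prod_univ_eq_prod_range
      (fun m => ENNReal.ofReal (stepProb ω x m))]
  · refine Finset.prod_congr rfl fun m _ => ?_
    simp only [stepProb]
    split_ifs with h1 h2
    · exact unif_Iic (hIcc _ _)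
    · exact unif_Ioi (hIcc _ _)
    · exact absurd (hx m m.2) (by tauto)
  · intro m _
    rw [stepProb]
    split_ifs
    · exact (hIcc _ _).1
    · linarith [(hIcc (x m) (prevVisits x m)).2]
    · exact le_rfl

end ArrowLaw

section Law

variable {ω : CEnv} {P Q : Measure (ℕ → ℤ)}

lemma measurableSet_forall_le_eq (x : ℕ → ℤ) (n : ℕ) :
    MeasurableSet {Y : ℕ → ℤ | ∀ m ≤ n, Y m = x m} := by
  simp only [ofPred_forall]
  exact .iInter fun m => .iInter fun _ => measurableSet_eq_fun (measurable_pi_apply m)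
    measurable_const

lemma IsERWLaw.unique {x0 : ℤ} (hP : IsERWLaw ω x0 P) (hQ : IsERWLaw ω x0 Q) : P = Q := by
  have := hP.1
  have := hQ.1
  have hfam : IsProjectiveMeasureFamily fun I : Finset ℕ => P.map I.restrict :=
    isProjectiveMeasureFamily_map_restrict (P := P) (X := fun n (Y : ℕ → ℤ) => Y n)
      fun t => (measurable_pi_apply t).aemeasurable
  have h1 : IsProjectiveLimit P fun I : Finset ℕ => P.map I.restrict := fun I => rfl
  have h2 : IsProjectiveLimit Q fun I : Finset ℕ => P.map I.restrict := by
    rw [isProjectiveLimit_nat_iff hfam]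
    intro n
    refine Measure.ext_of_singleton fun h => ?_
    set x : ℕ → ℤ := fun m => if hm : m ∈ Finset.Iic n then h ⟨m, hm⟩ else 0
    have hset : Preorder.frestrictLe (π := fun _ => ℤ) n ⁻¹' {h} = {Y | ∀ m ≤ n, Y m = x m} := by
      ext Y
      simp only [mem_preimage, mem_singleton_iff, mem_ofPred_eq, funext_iff, Subtype.forall,
        Finset.mem_Iic, Preorder.frestrictLe_apply]
      refine forall₂_congr fun m hm => ?_
      simp [x, hm]
    rw [Measure.map_apply (by fun_prop) (measurableSet_singleton h),
      Measure.map_apply (by fun_prop) (measurableSet_singleton h)]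
    change Q (Preorder.frestrictLe (π := fun _ => ℤ) n ⁻¹' {h}) =
      P (Preorder.frestrictLe (π := fun _ => ℤ) n ⁻¹' {h})
    rw [hset, hP.2, hQ.2]
  have : ∀ I : Finset ℕ, IsFiniteMeasure (P.map I.restrict) := fun I => inferInstance
  exact h1.unique h2

lemma stepProb_nonneg (hω : IsCookieEnv ω) (x : ℕ → ℤ) (n : ℕ) : 0 ≤ stepProb ω x n := by
  have := hω (x n) (prevVisits x n)
  rw [mem_Icc] at this
  rw [stepProb]
  split_ifs <;> linarith

lemma cylProb_nonneg (hω : IsCookieEnv ω) (x0 : ℤ) (x : ℕ → ℤ) (n : ℕ) :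
    0 ≤ cylProb ω x0 x n :=
  mul_nonneg (by split_ifs <;> norm_num) (Finset.prod_nonneg fun m _ => stepProb_nonneg hω x m)

/-- One step of the walk, on a cylinder. -/
lemma IsERWLaw.setLIntegral_cyl_le {x0 : ℤ} (hω : IsCookieEnv ω) (hP : IsERWLaw ω x0 P)
    (x : ℕ → ℤ) (t : ℕ) (f g : ℤ → ℝ≥0∞)
    (hfg : ∀ p ∈ Icc (1 / 2 : ℝ) 1,
      f (x t + 1) * ENNReal.ofReal p + f (x t - 1) * ENNReal.ofReal (1 - p) ≤ g (x t)) :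
    ∫⁻ Y in {Y | ∀ m ≤ t, Y m = x m}, f (Y (t + 1)) ∂P ≤
      ∫⁻ Y in {Y | ∀ m ≤ t, Y m = x m}, g (Y t) ∂P := by
  have hC := measurableSet_forall_le_eq x t
  set C := {Y : ℕ → ℤ | ∀ m ≤ t, Y m = x m}
  have hR : ∫⁻ Y in C, g (Y t) ∂P = g (x t) * P C := by
    rw [setLIntegral_congr_fun hC (g := fun _ => g (x t)) (fun Y hY => by rw [hY t le_rfl]),
      setLIntegral_const]
  set p := ω (x t) (prevVisits x t) with hp
  have hCz : ∀ z, P (C ∩ {Y | Y (t + 1) = z}) = P C *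
      (if z = x t + 1 then ENNReal.ofReal p else
        if z = x t - 1 then ENNReal.ofReal (1 - p) else 0) := by
    intro z
    have hset : C ∩ {Y | Y (t + 1) = z} =
        {Y | ∀ m ≤ t + 1, Y m = Function.update x (t + 1) z m} := by
      ext Y
      constructor
      · rintro ⟨h1, h2⟩ m hm
        rcases Nat.lt_or_ge m (t + 1) with h | h
        · rw [Function.update_of_ne (by omega)]; exact h1 m (by omega)
        · obtain rfl : m = t + 1 := by omega
          simpa using h2
      · intro h
        refine ⟨fun m hm => ?_, ?_⟩
        · rw [h m (by omega), Function.update_of_ne (by omega)]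
        · simpa using h (t + 1) le_rfl
    have hstep : ∀ m < t, stepProb ω (Function.update x (t + 1) z) m = stepProb ω x m := by
      intro m hm
      simp only [stepProb, prevVisits_eq_visits]
      rw [visits_congr (y := x) (fun k hk => Function.update_of_ne (by omega) _ _),
        Function.update_of_ne (by omega), Function.update_of_ne (by omega)]
    have hlast : stepProb ω (Function.update x (t + 1) z) t =
        if z = x t + 1 then p else if z = x t - 1 then 1 - p else 0 := by
      simp only [stepProb, hp, prevVisits_eq_visits]
      rw [visits_congr (y := x) (fun k hk => Function.update_of_ne (by omega) _ _),
        Function.update_of_ne (a := t) (by omega), Function.update_self]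
    have hcyl : cylProb ω x0 (Function.update x (t + 1) z) (t + 1) = cylProb ω x0 x t *
        if z = x t + 1 then p else if z = x t - 1 then 1 - p else 0 := by
      rw [cylProb, Finset.prod_range_succ, hlast, Finset.prod_congr rfl
        (fun m hm => hstep m (Finset.mem_range.1 hm)), Function.update_of_ne (by omega), cylProb,
        mul_assoc]
    rw [hset, hP.2, hcyl, ENNReal.ofReal_mul (cylProb_nonneg hω _ _ _), hP.2 x t]
    split_ifs <;> simp
  have hL : ∫⁻ Y in C, f (Y (t + 1)) ∂P = ∑' z, f z * P (C ∩ {Y | Y (t + 1) = z}) := by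
    have hm : ∀ z : ℤ, MeasurableSet {Y : ℕ → ℤ | Y (t + 1) = z} := fun z =>
      measurableSet_eq_fun (measurable_pi_apply _) measurable_const
    have hU : C = ⋃ z, C ∩ {Y | Y (t + 1) = z} := by
      ext Y; simp
    conv_lhs => rw [hU]
    rw [lintegral_iUnion (fun z => hC.inter (hm z))]
    · refine tsum_congr fun z => ?_
      rw [setLIntegral_congr_fun (hC.inter (hm z)) (g := fun _ => f z)
        (fun Y hY => by rw [hY.2]), setLIntegral_const]
    · intro z z' hzz
      refine Set.disjoint_left.2 fun Y h1 h2 => hzz ?_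
      exact h1.2.symm.trans h2.2
  rw [hL, hR]
  have hsplit : ∀ z, f z * P (C ∩ {Y | Y (t + 1) = z}) =
      (if z = x t + 1 then f (x t + 1) * ENNReal.ofReal p * P C else 0) +
      (if z = x t - 1 then f (x t - 1) * ENNReal.ofReal (1 - p) * P C else 0) := by
    intro z
    rw [hCz]
    split_ifs with h1 h2 h2
    · omega
    · rw [h1]; ring
    · rw [h2]; ring
    · simp
  simp_rw [hsplit]
  rw [ENNReal.tsum_add, tsum_ite_eq, tsum_ite_eq, ← add_mul]
  gcongr
  exact hfg p (hω _ _)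

/-- One step of the walk, on an event which only depends on the path up to time `t`. -/
lemma IsERWLaw.setLIntegral_le {x0 : ℤ} (hω : IsCookieEnv ω) (hP : IsERWLaw ω x0 P) (t : ℕ)
    {A : Set (ℕ → ℤ)} (hA : ∀ x ∈ A, ∀ Y, (∀ m ≤ t, Y m = x m) → Y ∈ A) (f g : ℤ → ℝ≥0∞)
    (hfg : ∀ x ∈ A, ∀ p ∈ Icc (1 / 2 : ℝ) 1,
      f (x t + 1) * ENNReal.ofReal p + f (x t - 1) * ENNReal.ofReal (1 - p) ≤ g (x t)) :
    ∫⁻ Y in A, f (Y (t + 1)) ∂P ≤ ∫⁻ Y in A, g (Y t) ∂P := by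
  classical
  let r : (ℕ → ℤ) → (Fin (t + 1) → ℤ) := fun Y m => Y m
  let e : (Fin (t + 1) → ℤ) → ℕ → ℤ := fun h m => if hm : m < t + 1 then h ⟨m, hm⟩ else 0
  have hre : ∀ Y h, r Y = h ↔ ∀ m ≤ t, Y m = e h m := by
    intro Y h
    simp only [funext_iff, Fin.forall_iff, Nat.lt_succ_iff]
    refine forall₂_congr fun m hm => ?_
    simp [r, e, hm]
  let C : (Fin (t + 1) → ℤ) → Set (ℕ → ℤ) := fun h =>
    if e h ∈ A then {Y | ∀ m ≤ t, Y m = e h m} else ∅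
  have hCm : ∀ h, MeasurableSet (C h) := by
    intro h
    simp only [C]
    split_ifs
    · exact measurableSet_forall_le_eq _ _
    · exact MeasurableSet.empty
  have hAC : A = ⋃ h, C h := by
    ext Y
    simp only [mem_iUnion]
    constructor
    · intro hY
      have h1 := (hre Y (r Y)).1 rfl
      refine ⟨r Y, ?_⟩
      have : e (r Y) ∈ A := hA Y hY _ fun m hm => (h1 m hm).symm
      simp only [C, if_pos this]
      exact h1
    · rintro ⟨h, hY⟩
      by_cases hh : e h ∈ A
      · simp only [C, if_pos hh] at hY
        exact hA _ hh Y hY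
      · simp [C, hh] at hY
  have hdisj : Pairwise (Function.onFun Disjoint C) := by
    intro h h' hne
    refine Set.disjoint_left.2 fun Y h1 h2 => hne ?_
    have hin : ∀ h, Y ∈ C h → r Y = h := by
      intro h hY
      by_cases hh : e h ∈ A
      · simp only [C, if_pos hh] at hY
        exact (hre Y h).2 hY
      · simp [C, hh] at hY
    rw [← hin h h1, hin h' h2]
  rw [hAC, lintegral_iUnion hCm hdisj, lintegral_iUnion hCm hdisj]
  refine ENNReal.tsum_le_tsum fun h => ?_
  by_cases hh : e h ∈ A
  · simp only [C, if_pos hh]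
    exact hP.setLIntegral_cyl_le hω (e h) t f g (hfg _ hh)
  · simp [C, hh]

lemma IsERWLaw.ae_zero (hP : IsERWLaw ω 0 P) : ∀ᵐ Y ∂P, Y 0 = 0 := by
  have := hP.1
  have h := hP.2 (fun _ => 0) 0
  have h1 : {Y : ℕ → ℤ | ∀ m ≤ 0, Y m = 0} = {Y | Y 0 = 0} := by ext Y; simp
  rw [h1] at h
  refine (mem_ae_iff_prob_eq_one ?_).2 ?_
  · exact measurableSet_eq_fun (measurable_pi_apply 0) measurable_const
  · change P {Y | Y 0 = 0} = 1
    rw [h]; simp [cylProb]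

end Law

section Estimates

variable {ω : CEnv} {P : Measure (ℕ → ℤ)}

lemma IsERWLaw.lintegral_exp_le (hω : IsCookieEnv ω) (hP : IsERWLaw ω 0 P) {l : ℝ} (hl : 0 ≤ l)
    (t : ℕ) :
    ∫⁻ Y, ENNReal.ofReal (Real.exp (-l * Y t)) ∂P ≤ ENNReal.ofReal (Real.cosh l ^ t) := by
  have := hP.1
  induction t with
  | zero =>
    have h0 : ∀ᵐ Y ∂P, ENNReal.ofReal (Real.exp (-l * (Y 0 : ℤ))) = 1 := by
      filter_upwards [hP.ae_zero] with Y hY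
      simp [hY]
    rw [lintegral_congr_ae h0]
    simp
  | succ t ih =>
    have h := hP.setLIntegral_le hω t (A := univ) (fun _ _ _ _ => mem_univ _)
      (fun y => ENNReal.ofReal (Real.exp (-l * y)))
      (fun y => ENNReal.ofReal (Real.cosh l) * ENNReal.ofReal (Real.exp (-l * y))) ?_
    · simp only [setLIntegral_univ] at h
      refine h.trans ?_
      rw [lintegral_const_mul' _ _ ENNReal.ofReal_ne_top, pow_succ', ENNReal.ofReal_mul
        (Real.cosh_pos l).le]
      gcongr
    · intro x _ p hp
      rw [← ENNReal.ofReal_mul (Real.exp_pos _).le, ← ENNReal.ofReal_mul (Real.exp_pos _).le,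
        ← ENNReal.ofReal_mul (Real.cosh_pos l).le, ← ENNReal.ofReal_add
          (mul_nonneg (Real.exp_pos _).le (by linarith [hp.1]))
          (mul_nonneg (Real.exp_pos _).le (by linarith [hp.2]))]
      refine ENNReal.ofReal_le_ofReal ?_
      push_cast
      have e1 : Real.exp (-l * (x t + 1)) = Real.exp (-l * x t) * Real.exp (-l) := by
        rw [← Real.exp_add]; ring_nf
      have e2 : Real.exp (-l * (x t - 1)) = Real.exp (-l * x t) * Real.exp l := by
        rw [← Real.exp_add]; ring_nf
      rw [e1, e2, Real.cosh_eq]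
      have h1 : Real.exp (-l) ≤ Real.exp l := Real.exp_le_exp.2 (by linarith)
      have h2 := Real.exp_pos (-l * x t)
      have h3 : Real.exp (-l) * p + Real.exp l * (1 - p) ≤ (Real.exp l + Real.exp (-l)) / 2 := by
        nlinarith [hp.1]
      nlinarith

/-- The walk does not go to the left at positive speed. -/
lemma IsERWLaw.ae_eventually_neg_mul_lt (hω : IsCookieEnv ω) (hP : IsERWLaw ω 0 P) {ε : ℝ}
    (hε : 0 < ε) : ∀ᵐ Y ∂P, ∀ᶠ n : ℕ in atTop, -(ε * n) < Y n := by
  have hr : Real.exp (-(ε ^ 2 / 2)) < 1 := by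
    rw [Real.exp_lt_one_iff]; nlinarith
  have hbound : ∀ n : ℕ, P {Y | (Y n : ℝ) ≤ -(ε * n)} ≤
      ENNReal.ofReal (Real.exp (-(ε ^ 2 / 2))) ^ n := by
    intro n
    set c := Real.exp (ε * (ε * n))
    have hc : 0 < c := Real.exp_pos _
    have h1 := mul_meas_ge_le_lintegral₀ (μ := P)
      (f := fun Y : ℕ → ℤ => ENNReal.ofReal (Real.exp (-ε * Y n)))
      ((Measurable.of_discrete (f := fun z : ℤ => ENNReal.ofReal (Real.exp (-ε * z)))).comp
        (measurable_pi_apply n)).aemeasurable (ENNReal.ofReal c)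
    have h2 : {Y : ℕ → ℤ | (Y n : ℝ) ≤ -(ε * n)} ⊆
        {Y | ENNReal.ofReal c ≤ ENNReal.ofReal (Real.exp (-ε * Y n))} := by
      intro Y hY
      rw [mem_ofPred_eq] at hY ⊢
      exact ENNReal.ofReal_le_ofReal (Real.exp_le_exp.2 (by nlinarith))
    have h3 := (mul_le_mul_right (measure_mono h2) (ENNReal.ofReal c)).trans
      (h1.trans (hP.lintegral_exp_le hω hε.le n))
    have h4 : Real.cosh ε ^ n ≤ Real.exp (ε ^ 2 / 2) ^ n :=
      pow_le_pow_left₀ (Real.cosh_pos _).le (Real.cosh_le_exp_half_sq ε) n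
    have h5 : Real.exp (ε ^ 2 / 2) ^ n = c * Real.exp (-(ε ^ 2 / 2)) ^ n := by
      rw [← Real.exp_nat_mul, ← Real.exp_nat_mul, ← Real.exp_add]; ring_nf
    have h6 := h3.trans (ENNReal.ofReal_le_ofReal (h4.trans_eq h5))
    rw [ENNReal.ofReal_mul hc.le] at h6
    rw [← ENNReal.ofReal_pow (Real.exp_pos _).le]
    exact (ENNReal.mul_le_mul_iff_right (by simpa using hc) ENNReal.ofReal_ne_top).1 h6
  have hsum : ∑' n : ℕ, P {Y | (Y n : ℝ) ≤ -(ε * n)} ≠ ∞ := by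
    refine ne_top_of_le_ne_top ?_ (ENNReal.tsum_le_tsum hbound)
    rw [ENNReal.tsum_geometric]
    refine ENNReal.inv_ne_top.2 (tsub_pos_iff_lt.2 ?_).ne'
    rw [← ENNReal.ofReal_one]
    exact (ENNReal.ofReal_lt_ofReal_iff one_pos).2 hr
  filter_upwards [ae_eventually_notMem hsum] with Y hY
  filter_upwards [hY] with n hn
  simpa using hn

/-- A function of the distance to the target, which decreases on average by at least `1` per step
while the distance is less than `K`. -/
def lyap (K : ℕ) (y : ℤ) : ℝ := if y ≤ K then y * (2 * K - y) else (K : ℝ) ^ 2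

lemma one_le_lyap {K : ℕ} (hK : 1 ≤ K) {y : ℤ} (hy : 1 ≤ y) : 1 ≤ lyap K y := by
  have h1 : (1 : ℝ) ≤ y := by exact_mod_cast hy
  have h2 : (1 : ℝ) ≤ K := by exact_mod_cast hK
  rw [lyap]
  split_ifs with h
  · have h3 : (y : ℝ) ≤ K := by exact_mod_cast h
    nlinarith
  · nlinarith

lemma lyap_nonneg {K : ℕ} (hK : 1 ≤ K) {y : ℤ} (hy : 0 ≤ y) : 0 ≤ lyap K y := by
  rcases hy.eq_or_lt with rfl | h
  · simp [lyap]
  · exact zero_le_one.trans (one_le_lyap hK h)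

lemma lyap_step {K : ℕ} (hK : 1 ≤ K) {y : ℤ} (hy : 1 ≤ y) {p : ℝ} (hp : p ∈ Icc (1 / 2 : ℝ) 1) :
    lyap K (y - 1) * p + lyap K (y + 1) * (1 - p) ≤ lyap K y - if y < K then 1 else 0 := by
  have h1 : (1 : ℝ) ≤ y := by exact_mod_cast hy
  have h2 : (1 : ℝ) ≤ K := by exact_mod_cast hK
  obtain ⟨hp1, hp2⟩ := hp
  rcases lt_trichotomy y K with h | h | h
  · have h3 : (y : ℝ) + 1 ≤ K := by exact_mod_cast h
    rw [lyap, lyap, lyap, if_pos (by omega), if_pos (by omega), if_pos (by omega), if_pos h]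
    push_cast
    nlinarith [mul_nonneg (sub_nonneg.2 h3) (sub_nonneg.2 hp1)]
  · rw [lyap, lyap, lyap, if_pos (by omega), if_neg (by omega), if_pos (by omega),
      if_neg (by omega), h]
    push_cast
    nlinarith
  · rw [lyap, lyap, lyap, if_neg (c := y + 1 ≤ K) (by omega), if_neg (c := y ≤ K) (by omega),
      if_neg (c := y < K) (by omega)]
    split_ifs with h4
    · have h5 : y = K + 1 := by omega
      subst h5
      push_cast
      nlinarith
    · linarith

/-- Almost surely the walk reaches every level. -/
lemma IsERWLaw.ae_exists_le (hω : IsCookieEnv ω) (hP : IsERWLaw ω 0 P) (n : ℕ) :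
    ∀ᵐ Y ∂P, ∃ t, (n : ℤ) ≤ Y t := by
  have := hP.1
  let A : ℕ → Set (ℕ → ℤ) := fun t => {Y | ∀ s ≤ t, Y s < n}
  have hAm : ∀ t, MeasurableSet (A t) := by
    intro t
    simp only [A, ofPred_forall]
    exact .iInter fun m => .iInter fun _ => measurableSet_lt (measurable_pi_apply m)
      measurable_const
  have hAanti : ∀ t, A (t + 1) ⊆ A t := fun t Y hY s hs => hY s (by omega)
  have hD : ∀ K : ℕ, 1 ≤ K → P {Y | ∀ t, Y t < n} ≤ ENNReal.ofReal (2 * n / K) := by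
    intro K hK
    have hK0 : (0 : ℝ) < K := by exact_mod_cast hK
    let B : ℕ → Set (ℕ → ℤ) := fun t => {Y | (n : ℤ) - Y t < K}
    have hBm : ∀ t, MeasurableSet (B t) := fun t =>
      measurableSet_lt (measurable_const.sub (measurable_pi_apply t)) measurable_const
    let a : ℕ → ℝ≥0∞ := fun t => ∫⁻ Y in A t, ENNReal.ofReal (lyap K (n - Y t)) ∂P
    let b : ℕ → ℝ≥0∞ := fun t => P (A t ∩ B t)
    have hstep : ∀ t, a (t + 1) + b t ≤ a t := by
      intro t
      have h1 := hP.setLIntegral_le hω t (A := A t)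
        (fun x hx Y hY s hs => by rw [hY s hs]; exact hx s hs)
        (fun z => ENNReal.ofReal (lyap K (n - z)))
        (fun z => ENNReal.ofReal (lyap K (n - z) - if (n : ℤ) - z < K then 1 else 0)) (by
          intro x hx p hp
          have hy : 1 ≤ (n : ℤ) - x t := by have := hx t le_rfl; omega
          rw [← ENNReal.ofReal_mul (lyap_nonneg hK (by omega)),
            ← ENNReal.ofReal_mul (lyap_nonneg hK (by omega)), ← ENNReal.ofReal_add
            (mul_nonneg (lyap_nonneg hK (by omega)) (by linarith [hp.1]))
            (mul_nonneg (lyap_nonneg hK (by omega)) (by linarith [hp.2]))]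
          refine ENNReal.ofReal_le_ofReal ?_
          convert lyap_step hK hy hp using 4 <;> ring)
      have h2 : a (t + 1) ≤ ∫⁻ Y in A t, ENNReal.ofReal (lyap K (n - Y (t + 1))) ∂P :=
        lintegral_mono_set (hAanti t)
      have h3 : b t = ∫⁻ Y in A t, (B t).indicator 1 Y ∂P := by
        rw [lintegral_indicator_one (hBm t), Measure.restrict_apply (hBm t), inter_comm]
      have h4 : a t = (∫⁻ Y in A t, ENNReal.ofReal
          (lyap K (n - Y t) - if (n : ℤ) - Y t < K then 1 else 0) ∂P) + b t := by
        rw [h3, ← lintegral_add_right _ (measurable_one.indicator (hBm t))]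
        refine setLIntegral_congr_fun (hAm t) fun Y hY => ?_
        have hy : 1 ≤ (n : ℤ) - Y t := by have := hY t le_rfl; omega
        have h5 := one_le_lyap hK hy
        by_cases hB : (n : ℤ) - Y t < K
        · simp only [hB, if_true]
          rw [indicator_of_mem (show Y ∈ B t from hB), Pi.one_apply, ← ENNReal.ofReal_one,
            ← ENNReal.ofReal_add (by linarith) zero_le_one]
          simp
        · simp only [hB, if_false]
          rw [indicator_of_notMem (show Y ∉ B t from hB)]
          simp
      rw [h4]
      gcongr
      exact h2.trans h1
    have ha0 : a 0 ≤ ENNReal.ofReal (2 * n * K) := by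
      have h1 : ∀ᵐ Y ∂P, ENNReal.ofReal (lyap K (n - Y 0)) ≤ ENNReal.ofReal (2 * n * K) := by
        filter_upwards [hP.ae_zero] with Y hY
        refine ENNReal.ofReal_le_ofReal ?_
        rw [hY, sub_zero, lyap]
        have hn : (0 : ℝ) ≤ n := Nat.cast_nonneg n
        split_ifs with h
        · push_cast; nlinarith
        · have : (K : ℝ) ≤ n := by exact_mod_cast (show K ≤ n by omega)
          nlinarith
      refine (lintegral_mono_ae (ae_restrict_of_ae h1)).trans ?_
      rw [setLIntegral_const]
      exact mul_le_of_le_one_right' prob_le_one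
    have hsumle : ∀ N, ∑ t ∈ Finset.range N, b t + a N ≤ a 0 := by
      intro N
      induction N with
      | zero => simp
      | succ N ih =>
        refine le_trans ?_ ih
        rw [Finset.sum_range_succ, add_assoc, add_comm (b N)]
        gcongr
        exact hstep N
    have hb : Tendsto b atTop (𝓝 0) := by
      refine ENNReal.tendsto_atTop_zero_of_tsum_ne_top ?_
      refine ne_top_of_le_ne_top (ENNReal.ofReal_ne_top (r := 2 * n * K)) ?_
      rw [ENNReal.tsum_eq_iSup_nat]
      exact iSup_le fun N => (le_self_add.trans (hsumle N)).trans ha0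
    have hfar : ∀ N, P (A N \ B N) ≤ ENNReal.ofReal (2 * n / K) := by
      intro N
      have h1 : ENNReal.ofReal ((K : ℝ) ^ 2) * P (A N \ B N) ≤ a N := by
        rw [← setLIntegral_const]
        refine le_trans ?_ (lintegral_mono_set (s := A N \ B N) sdiff_subset)
        refine setLIntegral_mono' ((hAm N).diff (hBm N)) fun Y hY => ENNReal.ofReal_le_ofReal ?_
        have h2 : ¬ (n : ℤ) - Y N < K := hY.2
        rw [lyap]
        split_ifs with h3
        · have h4 : (n : ℤ) - Y N = K := by omega
          rw [h4]; push_cast; nlinarith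
        · exact le_rfl
      have h2 := h1.trans ((le_add_self.trans (hsumle N)).trans ha0)
      have h3 : 2 * (n : ℝ) * K = (K : ℝ) ^ 2 * (2 * n / K) := by field_simp
      rw [h3, ENNReal.ofReal_mul (by positivity)] at h2
      exact (ENNReal.mul_le_mul_iff_right (by simpa using (by omega : K ≠ 0))
        ENNReal.ofReal_ne_top).1 h2
    have hlim : Tendsto (fun N => b N + ENNReal.ofReal (2 * n / K)) atTop
        (𝓝 (0 + ENNReal.ofReal (2 * n / K))) := hb.add tendsto_const_nhds
    rw [zero_add] at hlim
    refine ge_of_tendsto' hlim fun N => ?_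
    calc P {Y | ∀ t, Y t < n} ≤ P (A N) := measure_mono fun Y hY s _ => hY s
      _ = b N + P (A N \ B N) := (measure_inter_add_sdiff _ (hBm N)).symm
      _ ≤ _ := by gcongr; exact hfar N
  have hlim : Tendsto (fun K : ℕ => ENNReal.ofReal (2 * n / K)) atTop (𝓝 (ENNReal.ofReal 0)) :=
    ENNReal.tendsto_ofReal (tendsto_const_div_atTop_nhds_zero_nat _)
  rw [ENNReal.ofReal_zero] at hlim
  have h0 : P {Y | ∀ t, Y t < n} = 0 := le_antisymm
    (ge_of_tendsto hlim ((eventually_ge_atTop 1).mono hD)) zero_le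
  rw [ae_iff]
  simpa using h0

end Estimates

section Stacks

lemma measurable_count_true (m : ℕ) :
    Measurable fun s : ℕ → Bool => Nat.count (fun i => s i = true) m := by
  induction m with
  | zero => simp only [Nat.count_zero]; exact measurable_const
  | succ m ih =>
    simp only [Nat.count_succ]
    exact ih.add (Measurable.ite (measurableSet_eq_fun (measurable_pi_apply m) measurable_const)
      measurable_const measurable_const)

lemma measurable_rightIndex (d : ℕ) : Measurable fun s => rightIndex s d := by
  have hsucc : ∀ m, MeasurableSet ((fun s => rightIndex s d) ⁻¹' {m + 1}) := by
    intro m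
    have : (fun s => rightIndex s d) ⁻¹' {m + 1} =
        {s | s (m + 1) = true} ∩ {s | Nat.count (fun i => s i = true) (m + 1) = d} := by
      ext s
      refine ⟨fun h => ?_, fun h => rightIndex_eq h.1 h.2⟩
      have hne : rightIndex s d = m + 1 := h
      have := Nat.sInf_mem (Nat.nonempty_of_pos_sInf
        (show 0 < sInf {m | s m = true ∧ Nat.count (fun i => s i = true) m = d} by
          rw [rightIndex] at hne; omega))
      rw [rightIndex] at hne
      rwa [hne] at this
    rw [this]
    exact (measurable_pi_apply (m + 1) (measurableSet_singleton true)).inter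
      (measurable_count_true (m + 1) (measurableSet_singleton d))
  refine measurable_to_countable' fun m => ?_
  cases m with
  | succ m => exact hsucc m
  | zero =>
    have : (fun s => rightIndex s d) ⁻¹' {0} =
        (⋃ m, (fun s => rightIndex s d) ⁻¹' {m + 1})ᶜ := by
      ext s
      simp only [mem_preimage, mem_singleton_iff, mem_compl_iff, mem_iUnion, not_exists]
      exact ⟨fun h m => by omega, fun h => by
        by_contra h0
        exact h (rightIndex s d - 1) (by omega)⟩
    rw [this]
    exact (MeasurableSet.iUnion hsucc).compl

lemma Measurable.rightIndex {Ω : Type*} [MeasurableSpace Ω] {s : Ω → ℕ → Bool} {d : Ω → ℕ}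
    (hs : Measurable s) (hd : Measurable d) : Measurable fun x => rightIndex (s x) (d x) :=
  (measurable_from_prod_countable_right (f := fun p : ℕ × (ℕ → Bool) => _root_.rightIndex p.2 p.1)
    measurable_rightIndex).comp (hd.prodMk hs)

lemma measurable_stackDowns (J : ℕ) : Measurable (stackDowns J) := by
  induction J with
  | zero => exact measurable_const
  | succ J ih =>
    have h := ih.comp measurable_shiftSeq
    exact (Measurable.rightIndex (measurable_pi_apply 0) h).sub h

lemma measurable_stackVisits (J : ℕ) : Measurable (stackVisits J) := by
  cases J with
  | zero => exact measurable_const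
  | succ J =>
    have h := (measurable_stackDowns J).comp measurable_shiftSeq
    exact (Measurable.rightIndex (measurable_pi_apply 0) h).add_const 1

lemma measurable_stackTime (j : ℕ) : Measurable (stackTime j) :=
  Finset.measurable_fun_sum _ fun i _ =>
    ((measurable_stackVisits (i + 1)).comp (measurable_shiftSeq.iterate _)).sub
      ((measurable_stackVisits i).comp (measurable_shiftSeq.iterate _))

lemma measurable_stacksFrom (x : ℕ) : Measurable fun a => stacksFrom a x :=
  measurable_pi_lambda _ fun _ => measurable_pi_apply _

end Stacks

section Coupling

/-- The walk built from an environment and the uniform random variables. -/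
def coupledWalk (q : CEnv × (ℤ → ℕ → ℝ)) : ℕ → ℤ := arrowWalk (arrows q)

lemma measurable_coupledWalk : Measurable coupledWalk :=
  measurable_arrowWalk.comp measurable_arrows

variable {Pr : Measure CEnv}

lemma map_snd_compProd_eq [SFinite Pr] (hcookie : ∀ᵐ ω ∂Pr, IsCookieEnv ω)
    {κ : Kernel CEnv (ℕ → ℤ)} [IsMarkovKernel κ] (hκ : ∀ ω, IsCookieEnv ω → IsERWLaw ω 0 (κ ω)) :
    (Pr.compProd κ).map Prod.snd = (Pr.prod (unifStacks ℤ)).map coupledWalk := by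
  ext S hS
  rw [Measure.map_apply measurable_snd hS, Measure.map_apply measurable_coupledWalk hS,
    Measure.compProd_apply (measurable_snd hS), Measure.prod_apply (measurable_coupledWalk hS)]
  refine lintegral_congr_ae ?_
  filter_upwards [hcookie] with ω hω
  have h := (hκ ω hω).unique (isERWLaw_arrowWalk hω)
  rw [h]
  exact Measure.map_apply (measurable_coupledWalk.comp measurable_prodMk_left) hS

lemma ae_coupledWalk (hcookie : ∀ᵐ ω ∂Pr, IsCookieEnv ω) {p : (ℕ → ℤ) → Prop}
    (hp : MeasurableSet {Y | p Y})
    (h : ∀ ω P, IsCookieEnv ω → IsERWLaw ω 0 P → ∀ᵐ Y ∂P, p Y) :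
    ∀ᵐ q ∂(Pr.prod (unifStacks ℤ)), p (coupledWalk q) := by
  rw [Measure.ae_prod_iff_ae_ae (p := fun q => p (coupledWalk q)) (measurable_coupledWalk hp)]
  filter_upwards [hcookie] with ω hω
  exact ae_of_ae_map (measurable_coupledWalk.comp measurable_prodMk_left).aemeasurable
    (h ω _ hω (isERWLaw_arrowWalk hω))

lemma ae_isUnboundedPath_coupledWalk (hcookie : ∀ᵐ ω ∂Pr, IsCookieEnv ω) :
    ∀ᵐ q ∂(Pr.prod (unifStacks ℤ)), IsUnboundedPath (coupledWalk q) := by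
  have h : ∀ᵐ q ∂(Pr.prod (unifStacks ℤ)), ∀ n : ℕ, ∃ t, (n : ℤ) ≤ coupledWalk q t := by
    rw [ae_all_iff]
    intro n
    refine ae_coupledWalk (p := fun Y => ∃ t, (n : ℤ) ≤ Y t) hcookie ?_
      fun ω P hω hP => hP.ae_exists_le hω n
    simp only [ofPred_exists]
    exact .iUnion fun t => measurableSet_le measurable_const (measurable_pi_apply t)
  filter_upwards [h] with q hq
  refine ⟨isNNPath_arrowWalk _, fun n => ?_⟩
  by_contra! hn
  obtain ⟨t, ht⟩ := hq n
  have := (isNNPath_arrowWalk (arrows q)).lt_of_forall_ne (n := n) (by omega) (t := t + 1)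
    (fun s _ => hn s) t (by omega)
  exact absurd ht (by simpa [coupledWalk] using this)

lemma ae_eventually_neg_mul_lt_coupledWalk (hcookie : ∀ᵐ ω ∂Pr, IsCookieEnv ω) {ε : ℝ}
    (hε : 0 < ε) :
    ∀ᵐ q ∂(Pr.prod (unifStacks ℤ)), ∀ᶠ n : ℕ in atTop, -(ε * n) < coupledWalk q n := by
  refine ae_coupledWalk (p := fun Y => ∀ᶠ n : ℕ in atTop, -(ε * n) < Y n) hcookie ?_
    fun ω P hω hP => hP.ae_eventually_neg_mul_lt hω hε
  simp only [eventually_atTop, ofPred_exists, ofPred_forall]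
  refine .iUnion fun m => .iInter fun n => .iInter fun _ => ?_
  exact measurable_pi_apply (X := fun _ : ℕ => ℤ) n
    (MeasurableSet.of_discrete (s := {z : ℤ | -(ε * n) < z}))

/-- The law of the stacks of arrows at the sites `0, 1, …`. -/
def stackLaw (Pr : Measure CEnv) : Measure (ℕ → ℕ → Bool) :=
  (Pr.prod (unifStacks ℤ)).map fun q => stacksFrom (arrows q) 0

lemma measurable_stacksFrom_arrows (x : ℕ) :
    Measurable fun q : CEnv × (ℤ → ℕ → ℝ) => stacksFrom (arrows q) x :=
  (measurable_stacksFrom x).comp measurable_arrows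

instance [IsProbabilityMeasure Pr] : IsProbabilityMeasure (stackLaw Pr) :=
  Measure.isProbabilityMeasure_map (measurable_stacksFrom_arrows 0).aemeasurable

lemma ergodic_stackLaw [IsProbabilityMeasure Pr] (hstat : IsStatErgEnv Pr) : Ergodic shiftSeq (stackLaw Pr) := by
  have hres : Measurable restrictNN := measurable_pi_lambda _ fun _ => measurable_pi_apply _
  have hU : (unifStacks ℤ).map (fun U (z : ℕ) => U (z : ℤ)) = unifStacks ℕ :=
    Measure.map_infinitePi_infinitePi_of_inj
      (P := fun _ : ℤ => Measure.infinitePi fun _ : ℕ => unif) Nat.cast_injective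
  have hUm : Measurable fun (U : ℤ → ℕ → ℝ) (z : ℕ) => U (z : ℤ) :=
    measurable_pi_lambda _ fun _ => measurable_pi_apply _
  have := Measure.isProbabilityMeasure_map (μ := Pr) hres.aemeasurable
  have hlaw : stackLaw Pr = ((Pr.map restrictNN).prod (unifStacks ℕ)).map arrows := by
    rw [← hU, Measure.map_prod_map _ _ hres hUm, Measure.map_map measurable_arrows
      (hres.prodMap hUm), stackLaw]
    congr 1
    funext q z i
    rw [Bool.eq_iff_iff]
    simp only [stacksFrom, arrows, Function.comp_apply, zero_add, decide_eq_true_eq]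
    rfl
  have hmp : MeasurePreserving arrows ((Pr.map restrictNN).prod (unifStacks ℕ)) (stackLaw Pr) :=
    ⟨measurable_arrows, hlaw.symm⟩
  exact hmp.ergodic_of_ergodic_semiconj
    (Ergodic.prod_infinitePi hstat (Measure.infinitePi fun _ : ℕ => unif))
    measurable_shiftSeq fun q => rfl

end Coupling

section Speed

lemma T_add_le_iff {k l : ℤ} {c : ℕ} {Y : ℕ → ℤ} :
    T k Y + (c : ℕ∞) ≤ T l Y ↔ ∀ n, Y n = l → ∃ m, Y m = k ∧ m + c ≤ n := by
  have h1 : T k Y + (c : ℕ∞) ≤ T l Y ↔ ∀ n : ℕ, Y n = l → T k Y + c ≤ n := by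
    rw [T, T, le_sInf_iff]
    exact ⟨fun h n hn => h n ⟨n, rfl, hn⟩, by rintro h _ ⟨n, rfl, hn⟩; exact h n hn⟩
  rw [h1]
  refine forall₂_congr fun n _ => ⟨fun h => ?_, ?_⟩
  · have hne : {t : ℕ∞ | ∃ n : ℕ, (n : ℕ∞) = t ∧ Y n = k}.Nonempty := by
      by_contra hne
      rw [not_nonempty_iff_eq_empty] at hne
      rw [T, hne, sInf_empty, top_add] at h
      exact absurd h (by simp)
    obtain ⟨m, hm, hmk⟩ := csInf_mem hne
    refine ⟨m, hmk, ?_⟩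
    have h2 : T k Y = m := hm.symm
    rw [h2] at h
    exact_mod_cast h
  · rintro ⟨m, hm, hmn⟩
    have h2 : T k Y ≤ m := sInf_le ⟨m, rfl, hm⟩
    calc T k Y + (c : ℕ∞) ≤ m + c := by gcongr
      _ ≤ n := by exact_mod_cast hmn

lemma measurableSet_T_add_le (k l : ℤ) (c : ℕ) :
    MeasurableSet {Y : ℕ → ℤ | T k Y + (c : ℕ∞) ≤ T l Y} := by
  have h : ∀ n (z : ℤ), MeasurableSet {Y : ℕ → ℤ | Y n = z} := fun n z =>
    measurableSet_eq_fun (measurable_pi_apply n) measurable_const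
  have heq : {Y : ℕ → ℤ | T k Y + (c : ℕ∞) ≤ T l Y} =
      ⋂ n, ({Y | Y n = l}ᶜ ∪ ⋃ m, {Y | Y m = k} ∩ {_Y | m + c ≤ n}) := by
    ext Y
    simp only [mem_ofPred_eq, T_add_le_iff, mem_iInter, mem_union, mem_compl_iff, mem_iUnion,
      mem_inter_iff, imp_iff_not_or]
  rw [heq]
  exact .iInter fun n => (h n l).compl.union (.iUnion fun m => (h m k).inter (.const _))

lemma lintegral_natCast_eq_tsum {Ω : Type*} [MeasurableSpace Ω] (μ : Measure Ω) {X : Ω → ℕ}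
    (hX : Measurable X) : ∫⁻ x, (X x : ℝ≥0∞) ∂μ = ∑' j : ℕ, μ {x | j + 1 ≤ X x} := by
  have hm : ∀ j : ℕ, MeasurableSet {x | j + 1 ≤ X x} := fun j =>
    measurableSet_le measurable_const hX
  have h1 : ∀ x, (X x : ℝ≥0∞) = ∑' j : ℕ, {x | j + 1 ≤ X x}.indicator 1 x := by
    intro x
    rw [tsum_eq_sum (s := Finset.range (X x))]
    · rw [Finset.sum_congr rfl (g := fun _ => (1 : ℝ≥0∞))]
      · simp
      · intro j hj
        exact indicator_of_mem (s := {x | j + 1 ≤ X x}) (Finset.mem_range.1 hj) _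
    · intro j hj
      exact indicator_of_notMem (s := {x | j + 1 ≤ X x}) (fun h => hj (Finset.mem_range.2 h)) _
  simp_rw [h1]
  rw [lintegral_tsum fun j => (measurable_one.indicator (hm j)).aemeasurable]
  exact tsum_congr fun j => lintegral_indicator_one (hm j)

/-- The total number of visits to `0`, in terms of the stacks of arrows at `0, 1, …`. -/
def totalVisits (b : ℕ → ℕ → Bool) : ℝ≥0∞ := ⨆ J, (stackVisits J b : ℝ≥0∞)

variable {Pr : Measure CEnv}

lemma measurePreserving_stacksFrom [IsProbabilityMeasure Pr] (hstat : IsStatErgEnv Pr) (x : ℕ) :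
    MeasurePreserving (fun q => stacksFrom (arrows q) x) (Pr.prod (unifStacks ℤ))
      (stackLaw Pr) := by
  have h0 : MeasurePreserving (fun q => stacksFrom (arrows q) 0) (Pr.prod (unifStacks ℤ))
      (stackLaw Pr) := ⟨measurable_stacksFrom_arrows 0, rfl⟩
  have h := ((ergodic_stackLaw hstat).toMeasurePreserving.iterate x).comp h0
  convert h using 2 with q
  rw [Function.comp_apply, iterate_shiftSeq_stacksFrom, zero_add]

lemma stackLaw_le_stackTime [IsProbabilityMeasure Pr] (hstat : IsStatErgEnv Pr) (i j x : ℕ) :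
    stackLaw Pr {b | i ≤ stackTime j b} =
      Pr.prod (unifStacks ℤ) {q | i ≤ stackTime j (stacksFrom (arrows q) x)} :=
  ((measurePreserving_stacksFrom hstat x).measure_preimage
    (measurableSet_le measurable_const (measurable_stackTime j)).nullMeasurableSet).symm

lemma ae_monotone_stackVisits (hcookie : ∀ᵐ ω ∂Pr, IsCookieEnv ω) :
    ∀ᵐ b ∂stackLaw Pr, Monotone fun J => stackVisits J b := by
  have h : ∀ᵐ b ∂stackLaw Pr, ∀ J, stackVisits J b ≤ stackVisits (J + 1) b := by
    rw [ae_all_iff]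
    intro J
    rw [stackLaw, ae_map_iff (measurable_stacksFrom_arrows 0).aemeasurable
      (measurableSet_le (measurable_stackVisits _) (measurable_stackVisits _))]
    filter_upwards [ae_isUnboundedPath_coupledWalk hcookie] with q hq
    exact stackVisits_mono hq 0 (Nat.le_succ J)
  filter_upwards [h] with b hb
  exact monotone_nat_of_le_succ hb

lemma stackLaw_le_stackTime_of_le [IsProbabilityMeasure Pr] (hcookie : ∀ᵐ ω ∂Pr, IsCookieEnv ω) (hstat : IsStatErgEnv Pr)
    {j J : ℕ} (hj : j ≤ J) :
    stackLaw Pr {b | j ≤ stackTime J b} = stackLaw Pr {b | j ≤ stackTime j b} := by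
  rw [stackLaw_le_stackTime hstat j J (J + 1 - J), stackLaw_le_stackTime hstat j j (J + 1 - j)]
  refine measure_congr ?_
  filter_upwards [ae_isUnboundedPath_coupledWalk hcookie] with q hq
  refine propext ⟨fun h => ?_, fun h => ?_⟩
  · refine (le_stackTime_iff hq (by omega)).2 ?_
    have h1 : j ≤ stackTime J (stacksFrom (arrows q) (J + 1 - J)) := h
    rw [stackTime_eq_count hq (by omega)] at h1
    have := h1.trans (Nat.count_le _)
    have := hq.hitTime_lt_succ J
    simp only [coupledWalk] at this
    omega
  · exact le_trans (show j ≤ _ from h) (stackTime_mono hq hj (by omega))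

lemma stackLaw_le_stackTime_le [IsProbabilityMeasure Pr] (hcookie : ∀ᵐ ω ∂Pr, IsCookieEnv ω) (hstat : IsStatErgEnv Pr)
    (j J : ℕ) : stackLaw Pr {b | j ≤ stackTime J b} ≤ stackLaw Pr {b | j ≤ stackTime j b} := by
  rcases le_total j J with h | h
  · exact (stackLaw_le_stackTime_of_le hcookie hstat h).le
  · rw [stackLaw_le_stackTime hstat j J (j + 1 - J), stackLaw_le_stackTime hstat j j (j + 1 - j)]
    refine measure_mono_ae ?_
    filter_upwards [ae_isUnboundedPath_coupledWalk hcookie] with q hq hJ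
    exact le_trans (show j ≤ _ from hJ) (stackTime_mono hq h (by omega))

lemma lintegral_stackTime [IsProbabilityMeasure Pr] (hcookie : ∀ᵐ ω ∂Pr, IsCookieEnv ω) (hstat : IsStatErgEnv Pr) (J : ℕ) :
    ∫⁻ b, (stackTime J b : ℝ≥0∞) ∂stackLaw Pr = ∫⁻ b, (stackVisits J b : ℝ≥0∞) ∂stackLaw Pr := by
  have hm : ∀ i, Measurable fun b => ((stackVisits (i + 1) b - stackVisits i b : ℕ) : ℝ≥0∞) :=
    fun i => (Measurable.of_discrete (f := fun n : ℕ => (n : ℝ≥0∞))).comp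
      ((measurable_stackVisits (i + 1)).sub (measurable_stackVisits i))
  have h1 : ∫⁻ b, (stackTime J b : ℝ≥0∞) ∂stackLaw Pr = ∑ i ∈ Finset.range J,
      ∫⁻ b, ((stackVisits (i + 1) b - stackVisits i b : ℕ) : ℝ≥0∞) ∂stackLaw Pr := by
    simp only [stackTime, Nat.cast_sum]
    rw [lintegral_finsetSum (f := fun i b => ((stackVisits (i + 1) (shiftSeq^[J - 1 - i] b) -
      stackVisits i (shiftSeq^[J - 1 - i] b) : ℕ) : ℝ≥0∞)) _
      fun i _ => (hm i).comp (measurable_shiftSeq.iterate _)]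
    refine Finset.sum_congr rfl fun i _ => ?_
    exact ((ergodic_stackLaw hstat).toMeasurePreserving.iterate _).lintegral_comp (hm i)
  rw [h1, ← lintegral_finsetSum _ fun i _ => hm i]
  refine lintegral_congr_ae ?_
  filter_upwards [ae_monotone_stackVisits hcookie] with b hb
  rw [← Nat.cast_sum, Finset.sum_range_tsub hb]
  simp [stackVisits]

lemma lintegral_totalVisits_eq_iSup (hcookie : ∀ᵐ ω ∂Pr, IsCookieEnv ω) :
    ∫⁻ b, totalVisits b ∂stackLaw Pr = ⨆ J, ∫⁻ b, (stackVisits J b : ℝ≥0∞) ∂stackLaw Pr := by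
  refine lintegral_iSup' (fun J => ((Measurable.of_discrete (f := fun n : ℕ => (n : ℝ≥0∞))).comp
    (measurable_stackVisits J)).aemeasurable) ?_
  filter_upwards [ae_monotone_stackVisits hcookie] with b hb J J' h
  exact Nat.cast_le.2 (hb h)

lemma tsum_stackLaw_eq [IsProbabilityMeasure Pr] (hcookie : ∀ᵐ ω ∂Pr, IsCookieEnv ω) (hstat : IsStatErgEnv Pr) :
    ∑' j : ℕ, stackLaw Pr {b | j + 1 ≤ stackTime (j + 1) b} =
      ∫⁻ b, totalVisits b ∂stackLaw Pr := by
  rw [lintegral_totalVisits_eq_iSup hcookie]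
  simp only [← lintegral_stackTime hcookie hstat]
  apply le_antisymm
  · rw [ENNReal.tsum_eq_iSup_nat]
    refine iSup_mono fun J => ?_
    rw [lintegral_natCast_eq_tsum _ (measurable_stackTime J)]
    refine le_trans (Finset.sum_le_sum fun j hj => ?_) (ENNReal.sum_le_tsum (Finset.range J))
    exact (stackLaw_le_stackTime_of_le hcookie hstat (Finset.mem_range.1 hj)).ge
  · refine iSup_le fun J => ?_
    rw [lintegral_natCast_eq_tsum _ (measurable_stackTime J)]
    exact ENNReal.tsum_le_tsum fun j => stackLaw_le_stackTime_le hcookie hstat _ _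

lemma compProd_T_add_le_eq [IsProbabilityMeasure Pr] (hcookie : ∀ᵐ ω ∂Pr, IsCookieEnv ω) (hstat : IsStatErgEnv Pr)
    {κ : Kernel CEnv (ℕ → ℤ)} [IsMarkovKernel κ] (hκ : ∀ ω, IsCookieEnv ω → IsERWLaw ω 0 (κ ω))
    (j : ℕ) :
    (Pr.compProd κ) {p | T ((j : ℤ) + 1) p.2 + ((j + 1 : ℕ) : ℕ∞) ≤ T ((j : ℤ) + 2) p.2} =
      stackLaw Pr {b | j + 1 ≤ stackTime (j + 1) b} := by
  have hS := measurableSet_T_add_le ((j : ℤ) + 1) ((j : ℤ) + 2) (j + 1)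
  have h1 := Measure.map_apply (μ := Pr.compProd κ) measurable_snd hS
  have h2 := Measure.map_apply (μ := Pr.prod (unifStacks ℤ)) measurable_coupledWalk hS
  rw [map_snd_compProd_eq hcookie hκ, h2] at h1
  refine h1.symm.trans ?_
  rw [stackLaw_le_stackTime hstat _ _ (j + 1 + 1 - (j + 1))]
  refine measure_congr ?_
  filter_upwards [ae_isUnboundedPath_coupledWalk hcookie] with q hq
  have h3 := hq.T_eq_hitTime (j + 1)
  have h4 := hq.T_eq_hitTime (j + 1 + 1)
  rw [show ((j + 1 : ℕ) : ℤ) = j + 1 by push_cast; ring] at h3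
  rw [show ((j + 1 + 1 : ℕ) : ℤ) = j + 2 by push_cast; ring] at h4
  have h5 := le_stackTime_iff hq (show j + 1 ≤ j + 1 + 1 by omega)
  refine propext ?_
  change T ((j : ℤ) + 1) (coupledWalk q) + ((j + 1 : ℕ) : ℕ∞) ≤ T ((j : ℤ) + 2) (coupledWalk q) ↔
    j + 1 ≤ stackTime (j + 1) (stacksFrom (arrows q) (j + 1 + 1 - (j + 1)))
  rw [h5, h3, h4, ← Nat.cast_add, Nat.cast_le]
  push_cast
  rw [coupledWalk, add_assoc (j : ℤ) 1 1]
  rfl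

lemma one_le_lintegral_totalVisits [IsProbabilityMeasure Pr] :
    1 ≤ ∫⁻ b, totalVisits b ∂stackLaw Pr := by
  calc (1 : ℝ≥0∞) = ∫⁻ _, 1 ∂stackLaw Pr := by simp
    _ ≤ _ := lintegral_mono fun b => by
        refine le_trans ?_ (le_iSup (fun J => (stackVisits J b : ℝ≥0∞)) 1)
        exact_mod_cast Nat.le_add_left 1 _

end Speed

section LimitSpeed

lemma tendsto_div_of_eventually_le {y : ℕ → ℝ} {L : ℝ}
    (h1 : ∀ l > L, ∀ᶠ m : ℕ in atTop, y m ≤ l * m)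
    (h2 : ∀ l < L, ∀ᶠ m : ℕ in atTop, l * m ≤ y m) :
    Tendsto (fun m : ℕ => y m / m) atTop (𝓝 L) := by
  refine tendsto_order.2 ⟨fun l hl => ?_, fun l hl => ?_⟩
  · obtain ⟨l', hl', hl''⟩ := exists_between hl
    filter_upwards [h2 l' hl'', eventually_gt_atTop 0] with m hm hm0
    exact hl'.trans_le ((le_div_iff₀ (by exact_mod_cast hm0)).2 hm)
  · obtain ⟨l', hl', hl''⟩ := exists_between hl
    filter_upwards [h1 l' hl', eventually_gt_atTop 0] with m hm hm0
    exact ((div_le_iff₀ (by exact_mod_cast hm0)).2 hm).trans_lt hl''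

lemma eventually_const_le_mul {d : ℝ} (hd : 0 < d) (C : ℝ) :
    ∀ᶠ m : ℕ in atTop, C ≤ d * m :=
  ((tendsto_natCast_atTop_atTop (R := ℝ)).const_mul_atTop hd).eventually_ge_atTop C

lemma hitTime_le_of_eq {Y : ℕ → ℤ} {n m : ℕ} (h : Y m = n) : hitTime Y n ≤ m :=
  Nat.sInf_le (s := {t | Y t = n}) h

lemma mul_le_add_abs_of_le_hitTime {Y : ℕ → ℤ} {c C : ℝ} (hc : 0 < c)
    (h : ∀ n : ℕ, c * n - C ≤ hitTime Y n) (m : ℕ) : c * Y m ≤ m + |C| := by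
  rcases lt_or_ge (Y m) 0 with h0 | h0
  · have : (Y m : ℝ) < 0 := by exact_mod_cast h0
    have := mul_neg_of_pos_of_neg hc this
    linarith [abs_nonneg C, Nat.cast_nonneg (α := ℝ) m]
  · obtain ⟨k, hk⟩ := Int.eq_ofNat_of_zero_le h0
    have h1 : (hitTime Y k : ℝ) ≤ m := by exact_mod_cast hitTime_le_of_eq hk
    rw [hk]
    have := h k
    have := le_abs_self C
    push_cast
    linarith

lemma eventually_le_mul_of_le_hitTime {Y : ℕ → ℤ} {c C l : ℝ} (hc : 0 < c)
    (h : ∀ n : ℕ, c * n - C ≤ hitTime Y n) (hl : c⁻¹ < l) : ∀ᶠ m : ℕ in atTop, Y m ≤ l * m := by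
  filter_upwards [eventually_const_le_mul (sub_pos.2 hl) (c⁻¹ * |C|)] with m hm
  have := (le_inv_mul_iff₀ hc).2 (mul_le_add_abs_of_le_hitTime hc h m)
  linarith

lemma tendsto_div_zero_of_le_hitTime {Y : ℕ → ℤ}
    (h₁ : ∀ c : ℚ, ∃ C : ℝ, ∀ n : ℕ, c * n - C ≤ hitTime Y n)
    (h₂ : ∀ k : ℕ, ∀ᶠ m : ℕ in atTop, -(1 / ((k : ℝ) + 1) * m) < Y m) :
    Tendsto (fun m : ℕ => (Y m : ℝ) / m) atTop (𝓝 0) := by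
  refine tendsto_div_of_eventually_le (fun l hl => ?_) (fun l hl => ?_)
  · obtain ⟨c, hc⟩ := exists_rat_gt l⁻¹
    obtain ⟨C, hC⟩ := h₁ c
    exact eventually_le_mul_of_le_hitTime ((inv_pos.2 hl).trans hc) hC (inv_lt_of_inv_lt₀ hl hc)
  · obtain ⟨k, hk⟩ := exists_nat_one_div_lt (neg_pos.2 hl)
    filter_upwards [h₂ k] with m hm
    have := mul_le_mul_of_nonneg_right hk.le (Nat.cast_nonneg (α := ℝ) m)
    linarith

namespace IsUnboundedPath

variable {Y : ℕ → ℤ}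

lemma le_hitTime (hY : IsUnboundedPath Y) (n : ℕ) : n ≤ hitTime Y n :=
  (show StrictMono fun n : ℕ => hitTime Y (n : ℤ) from hY.hitTime_strictMono).le_apply

lemma mul_sub_le (hY : IsUnboundedPath Y) {c₁ c₂ C₁ C₂ : ℝ} (hc₁ : 0 < c₁)
    (h₁ : ∀ n : ℕ, c₁ * n - C₁ ≤ hitTime Y n) (hc₂ : 0 < c₂)
    (h₂ : ∀ n : ℕ, hitTime Y n ≤ c₂ * n + C₂) (m : ℕ) :
    ((1 + c₁) / c₂ - 1) * m - ((1 + c₁) * (C₂ + c₂) / c₂ + C₁) ≤ Y m := by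
  obtain ⟨n, hn, hn'⟩ : ∃ n : ℕ, hitTime Y n ≤ m ∧ m < hitTime Y (n + 1 : ℕ) := by
    have hex : ∃ n : ℕ, m < hitTime Y n := ⟨m + 1, hY.le_hitTime (m + 1)⟩
    have h0 : hitTime Y (0 : ℕ) ≤ m := (hitTime_le_of_eq (m := 0) hY.zero).trans (Nat.zero_le _)
    obtain ⟨k, hk⟩ : ∃ k, Nat.find hex = k + 1 :=
      Nat.exists_eq_succ_of_ne_zero fun h => absurd (h ▸ Nat.find_spec hex) (not_lt.2 h0)
    exact ⟨k, not_lt.1 (Nat.find_min hex (by omega)), hk ▸ Nat.find_spec hex⟩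
  have h3 : (m : ℝ) ≤ c₂ * n + (C₂ + c₂) := by
    have := h₂ (n + 1)
    have h4 : (m : ℝ) ≤ hitTime Y (n + 1 : ℕ) := by exact_mod_cast hn'.le
    push_cast at this h4
    linarith
  have h5 : (1 + c₁) / c₂ * m - (1 + c₁) * (C₂ + c₂) / c₂ ≤ (1 + c₁) * n := by
    rw [← sub_nonneg]
    have : (1 + c₁) * n - ((1 + c₁) / c₂ * m - (1 + c₁) * (C₂ + c₂) / c₂) =
        (1 + c₁) / c₂ * (c₂ * n + (C₂ + c₂) - m) := by field_simp; ring
    rw [this]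
    exact mul_nonneg (by positivity) (by linarith)
  have h6 : (n : ℝ) - (m - hitTime Y n) ≤ Y m := by
    have := (hY.abs_sub_le (hitTime Y n) (m - hitTime Y n)).1
    rw [hY.apply_hitTime, Nat.add_sub_cancel' hn] at this
    rw [← Nat.cast_sub hn]
    exact_mod_cast this
  have := h₁ n
  linarith

lemma eventually_mul_le (hY : IsUnboundedPath Y) {c₁ c₂ C₁ C₂ l : ℝ} (hc₁ : 0 < c₁)
    (h₁ : ∀ n : ℕ, c₁ * n - C₁ ≤ hitTime Y n) (hc₂ : 0 < c₂)
    (h₂ : ∀ n : ℕ, hitTime Y n ≤ c₂ * n + C₂) (hl : l < (1 + c₁) / c₂ - 1) :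
    ∀ᶠ m : ℕ in atTop, l * m ≤ Y m := by
  filter_upwards [eventually_const_le_mul (sub_pos.2 hl)
    ((1 + c₁) * (C₂ + c₂) / c₂ + C₁)] with m hm
  have := hY.mul_sub_le hc₁ h₁ hc₂ h₂ m
  linarith

/-- If the first passage times have speed `u`, then the path has speed `u⁻¹`. -/
lemma tendsto_div (hY : IsUnboundedPath Y) {u : ℝ} (hu : 0 < u)
    (h₁ : ∀ c : ℚ, (c : ℝ) < u → ∃ C : ℝ, ∀ n : ℕ, c * n - C ≤ hitTime Y n)
    (h₂ : ∀ c : ℚ, u < (c : ℝ) → ∃ C : ℝ, ∀ n : ℕ, hitTime Y n ≤ c * n + C) :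
    Tendsto (fun m : ℕ => (Y m : ℝ) / m) atTop (𝓝 u⁻¹) := by
  refine tendsto_div_of_eventually_le (fun l hl => ?_) (fun l hl => ?_)
  · have hl0 : 0 < l := (inv_pos.2 hu).trans hl
    obtain ⟨c, hc, hcu⟩ := exists_rat_btwn (inv_lt_of_inv_lt₀ hu hl)
    obtain ⟨C, hC⟩ := h₁ c hcu
    have hc0 : (0 : ℝ) < c := (inv_pos.2 hl0).trans hc
    exact eventually_le_mul_of_le_hitTime hc0 hC (inv_lt_of_inv_lt₀ hl0 hc)
  · obtain ⟨l', hll', hl'0, hl'⟩ : ∃ l', l ≤ l' ∧ 0 ≤ l' ∧ l' < u⁻¹ :=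
      ⟨max l 0, le_max_left _ _, le_max_right _ _, max_lt hl (inv_pos.2 hu)⟩
    have h3 : u * (1 + l') < 1 + u := by
      have := mul_lt_mul_of_pos_left hl' hu
      rw [mul_inv_cancel₀ hu.ne'] at this
      linarith
    obtain ⟨c₂, hc₂, hc₂'⟩ := exists_rat_btwn ((lt_div_iff₀ (by positivity)).2 h3)
    rw [lt_div_iff₀ (by positivity)] at hc₂'
    obtain ⟨c₁, hc₁, hc₁'⟩ := exists_rat_btwn
      (max_lt (show (c₂ : ℝ) * (1 + l') - 1 < u by linarith) hu)
    obtain ⟨C₁, hC₁⟩ := h₁ c₁ hc₁'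
    obtain ⟨C₂, hC₂⟩ := h₂ c₂ hc₂
    have hc₂0 : (0 : ℝ) < c₂ := hu.trans hc₂
    refine hY.eventually_mul_le ((le_max_right _ _).trans_lt hc₁) hC₁ hc₂0 hC₂
      (hll'.trans_lt ?_)
    rw [lt_sub_iff_add_lt, lt_div_iff₀ hc₂0]
    have := (le_max_left _ _).trans_lt hc₁
    linarith

/-- A path that visits `0` finitely often spends a bounded time at negative sites. -/
lemma exists_count_neg_le (hY : IsUnboundedPath Y) {B : ℕ} (hB : ∀ t, visits Y 0 t ≤ B) :
    ∃ C, ∀ t, Nat.count (fun s => Y s < 0) t ≤ C := by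
  have hfin : {s | Y s = 0}.Finite := by
    by_contra hinf
    have := hB (Nat.nth (fun s => Y s = 0) (B + 1))
    rw [visits, Nat.count_nth_of_infinite (p := fun s => Y s = 0) hinf] at this
    omega
  obtain ⟨N, hN⟩ := hfin.bddAbove
  have hpos : ∀ s, 0 < Y (hitTime Y (N + 1 : ℕ) + s) := by
    intro s
    induction s with
    | zero => rw [add_zero, hY.apply_hitTime]; positivity
    | succ s ih =>
      have h1 : Y (hitTime Y (N + 1 : ℕ) + (s + 1)) ≠ 0 := fun h => by
        have h2 : hitTime Y (N + 1 : ℕ) + (s + 1) ≤ N := hN h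
        have := hY.le_hitTime (N + 1)
        omega
      have := hY.step (hitTime Y (N + 1 : ℕ) + s)
      rw [← add_assoc] at h1 ⊢
      omega
  refine ⟨hitTime Y (N + 1 : ℕ), fun t => ?_⟩
  rcases le_total t (hitTime Y (N + 1 : ℕ)) with h | h
  · exact (Nat.count_le _).trans h
  · obtain ⟨s, rfl⟩ := Nat.exists_eq_add_of_le h
    rw [Nat.count_add, Nat.count_of_forall_not fun i _ => (hpos i).le.not_gt]
    exact Nat.count_le _

end IsUnboundedPath
end LimitSpeed

section PassageSpeed

lemma hitTime_le_sum {a : ℤ → ℕ → Bool} (ha : IsUnboundedPath (arrowWalk a))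
    (hfin : ∀ x, totalVisits (stacksFrom a x) ≠ ∞) :
    ∃ C : ℝ, ∀ n : ℕ, (hitTime (arrowWalk a) n : ℝ) ≤
      birkhoffSum shiftSeq (fun b => (totalVisits b).toReal) n (stacksFrom a 0) + C := by
  have hle : ∀ J x, (stackVisits J (stacksFrom a x) : ℝ) ≤ (totalVisits (stacksFrom a x)).toReal :=
    fun J x => by
      simpa using ENNReal.toReal_mono (hfin x)
        (le_iSup (fun J => (stackVisits J (stacksFrom a x) : ℝ≥0∞)) J)
  have hB : ∀ t, visits (arrowWalk a) 0 t ≤ ⌊(totalVisits (stacksFrom a 0)).toReal⌋₊ := by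
    intro t
    refine Nat.le_floor (le_trans ?_ (hle t 0))
    have h := visits_hitTime ha 0 t
    rw [zero_add] at h
    rw [← h]
    exact_mod_cast Nat.count_monotone _ (ha.le_hitTime t)
  obtain ⟨C, hC⟩ := ha.exists_count_neg_le hB
  refine ⟨C, fun n => ?_⟩
  conv_lhs => rw [hitTime_eq_sum ha n]
  push_cast
  refine add_le_add ?_ (by exact_mod_cast hC _)
  refine Finset.sum_le_sum fun x _ => ?_
  rw [iterate_shiftSeq_stacksFrom, zero_add]
  exact hle _ _

lemma birkhoffSum_le_hitTime {a : ℤ → ℕ → Bool} (ha : IsUnboundedPath (arrowWalk a))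
    (J n : ℕ) :
    birkhoffSum shiftSeq (fun b => (stackVisits J b : ℝ)) n (stacksFrom a 0) ≤
      hitTime (arrowWalk a) (n + J : ℕ) := by
  calc birkhoffSum shiftSeq (fun b => (stackVisits J b : ℝ)) n (stacksFrom a 0)
      ≤ ∑ x ∈ Finset.range n, (stackVisits (n + J - x) (stacksFrom a x) : ℝ) := by
        refine Finset.sum_le_sum fun x hx => ?_
        have hx := Finset.mem_range.1 hx
        rw [iterate_shiftSeq_stacksFrom, zero_add]
        exact Nat.cast_le.2 (stackVisits_mono ha x (show J ≤ n + J - x by omega))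
    _ ≤ ∑ x ∈ Finset.range (n + J), (stackVisits (n + J - x) (stacksFrom a x) : ℝ) :=
        Finset.sum_le_sum_of_subset_of_nonneg (Finset.range_mono (Nat.le_add_right n J))
          fun _ _ _ => Nat.cast_nonneg _
    _ ≤ _ := by
        rw [hitTime_eq_sum ha (n + J)]
        exact_mod_cast Nat.le_add_right _ _

variable {Pr : Measure CEnv} [IsProbabilityMeasure Pr]

lemma ae_exists_hitTime_le (hcookie : ∀ᵐ ω ∂Pr, IsCookieEnv ω) (hstat : IsStatErgEnv Pr)
    (hfin : ∫⁻ b, totalVisits b ∂stackLaw Pr ≠ ∞) {c : ℝ}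
    (hc : (∫⁻ b, totalVisits b ∂stackLaw Pr).toReal < c) :
    ∀ᵐ q ∂(Pr.prod (unifStacks ℤ)), ∃ C : ℝ, ∀ n : ℕ,
      (hitTime (coupledWalk q) n : ℝ) ≤ c * n + C := by
  have hm : Measurable totalVisits := .iSup fun J =>
    (Measurable.of_discrete (f := fun n : ℕ => (n : ℝ≥0∞))).comp (measurable_stackVisits J)
  have hlt := ae_lt_top hm hfin
  have hall : ∀ᵐ q ∂(Pr.prod (unifStacks ℤ)), ∀ x, totalVisits (stacksFrom (arrows q) x) < ∞ :=
    ae_all_iff.2 fun x => (measurePreserving_stacksFrom hstat x).quasiMeasurePreserving.ae hlt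
  have hb := (ergodic_stackLaw hstat).ae_exists_birkhoffSum_le_mul_add hm.ennreal_toReal
    (integrable_toReal_of_lintegral_ne_top hm.aemeasurable hfin)
    (by rwa [integral_toReal hm.aemeasurable hlt])
  filter_upwards [hall, ae_isUnboundedPath_coupledWalk hcookie,
    (measurePreserving_stacksFrom hstat 0).quasiMeasurePreserving.ae hb] with q h1 h2 ⟨C, hC⟩
  obtain ⟨C', hC'⟩ := hitTime_le_sum h2 fun x => (h1 x).ne
  refine ⟨C + C', fun n => (hC' n).trans ?_⟩
  have := hC n
  linarith

lemma ae_exists_le_hitTime (hcookie : ∀ᵐ ω ∂Pr, IsCookieEnv ω) (hstat : IsStatErgEnv Pr)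
    {c : ℝ} (hc : ENNReal.ofReal c < ∫⁻ b, totalVisits b ∂stackLaw Pr) :
    ∀ᵐ q ∂(Pr.prod (unifStacks ℤ)), ∃ C : ℝ, ∀ n : ℕ,
      c * n - C ≤ (hitTime (coupledWalk q) n : ℝ) := by
  obtain ⟨J, M, hJM⟩ : ∃ J M : ℕ,
      ENNReal.ofReal c < ∫⁻ b, ((min (stackVisits J b) M : ℕ) : ℝ≥0∞) ∂stackLaw Pr := by
    rw [lintegral_totalVisits_eq_iSup hcookie] at hc
    obtain ⟨J, hJ⟩ := lt_iSup_iff.1 hc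
    have h : ∀ b, (stackVisits J b : ℝ≥0∞) =
        ⨆ M : ℕ, ((min (stackVisits J b) M : ℕ) : ℝ≥0∞) := fun b =>
      le_antisymm (le_iSup_of_le (stackVisits J b) (by simp))
        (iSup_le fun M => by exact_mod_cast min_le_left _ _)
    simp_rw [h] at hJ
    rw [lintegral_iSup] at hJ
    · exact ⟨J, lt_iSup_iff.1 hJ⟩
    · exact fun M => (Measurable.of_discrete (f := fun n : ℕ => ((min n M : ℕ) : ℝ≥0∞))).comp
        (measurable_stackVisits J)
    · exact fun M M' h b => by
        have := min_le_min_left (stackVisits J b) h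
        exact_mod_cast this
  have hm : Measurable fun b => ((min (stackVisits J b) M : ℕ) : ℝ) :=
    (Measurable.of_discrete (f := fun n : ℕ => ((min n M : ℕ) : ℝ))).comp
      (measurable_stackVisits J)
  have hi : Integrable (fun b => ((min (stackVisits J b) M : ℕ) : ℝ)) (stackLaw Pr) :=
    .of_bound hm.aestronglyMeasurable M (.of_forall fun b => by
      rw [Real.norm_of_nonneg (Nat.cast_nonneg _)]
      exact_mod_cast min_le_right _ _)
  have hc' : c < ∫ b, ((min (stackVisits J b) M : ℕ) : ℝ) ∂stackLaw Pr := by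
    refine (ENNReal.ofReal_lt_ofReal_iff'.1 ?_).1
    rw [ofReal_integral_eq_lintegral_ofReal hi (.of_forall fun _ => Nat.cast_nonneg _)]
    simpa only [ENNReal.ofReal_natCast] using hJM
  filter_upwards [ae_isUnboundedPath_coupledWalk hcookie,
    (measurePreserving_stacksFrom hstat 0).quasiMeasurePreserving.ae
      ((ergodic_stackLaw hstat).ae_exists_mul_sub_le_birkhoffSum hm hi hc')] with q h1 ⟨C, hC⟩
  refine ⟨|C| + |c| * J, fun n => ?_⟩
  rcases lt_or_ge n J with h | h
  · have h3 : c * n ≤ |c| * J := mul_le_mul (le_abs_self c) (by exact_mod_cast h.le)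
      (Nat.cast_nonneg _) (abs_nonneg _)
    have h4 : (0 : ℝ) ≤ hitTime (coupledWalk q) n := Nat.cast_nonneg _
    have := abs_nonneg C
    linarith
  · obtain ⟨k, rfl⟩ := Nat.exists_eq_add_of_le' h
    have h3 : birkhoffSum shiftSeq (fun b => ((min (stackVisits J b) M : ℕ) : ℝ)) k
        (stacksFrom (arrows q) 0) ≤ hitTime (coupledWalk q) (k + J : ℕ) :=
      (Finset.sum_le_sum fun x _ => Nat.cast_le.2 (min_le_left _ _)).trans
        (birkhoffSum_le_hitTime h1 J k)
    have h4 := hC k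
    have h5 := le_abs_self C
    have h6 : c * J ≤ |c| * J := mul_le_mul_of_nonneg_right (le_abs_self c) (Nat.cast_nonneg _)
    rw [Nat.cast_add, mul_add]
    linarith

/-- The coupled walk has speed `1 / u`, where `u` is the mean of the total number of visits. -/
lemma ae_tendsto_coupledWalk_div (hcookie : ∀ᵐ ω ∂Pr, IsCookieEnv ω) (hstat : IsStatErgEnv Pr) :
    ∀ᵐ q ∂(Pr.prod (unifStacks ℤ)), Tendsto (fun n : ℕ => (coupledWalk q n : ℝ) / n) atTop
      (𝓝 (∫⁻ b, totalVisits b ∂stackLaw Pr)⁻¹.toReal) := by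
  have hlow : ∀ᵐ q ∂(Pr.prod (unifStacks ℤ)), ∀ c : ℚ,
      ENNReal.ofReal c < ∫⁻ b, totalVisits b ∂stackLaw Pr → ∃ C : ℝ, ∀ n : ℕ,
        c * n - C ≤ (hitTime (coupledWalk q) n : ℝ) := by
    simp_rw [ae_all_iff]
    exact fun c hc => ae_exists_le_hitTime hcookie hstat hc
  by_cases hfin : ∫⁻ b, totalVisits b ∂stackLaw Pr = ∞
  · rw [hfin, ENNReal.inv_top, ENNReal.toReal_zero]
    have hneg := ae_all_iff.2 fun k : ℕ =>
      ae_eventually_neg_mul_lt_coupledWalk hcookie (Nat.one_div_pos_of_nat (α := ℝ) (n := k))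
    filter_upwards [hlow, hneg] with q h1 h2
    exact tendsto_div_zero_of_le_hitTime (fun c => h1 c (hfin ▸ ENNReal.ofReal_lt_top)) h2
  · have hup : ∀ᵐ q ∂(Pr.prod (unifStacks ℤ)), ∀ c : ℚ,
        (∫⁻ b, totalVisits b ∂stackLaw Pr).toReal < c → ∃ C : ℝ, ∀ n : ℕ,
          (hitTime (coupledWalk q) n : ℝ) ≤ c * n + C := by
      simp_rw [ae_all_iff]
      exact fun c hc => ae_exists_hitTime_le hcookie hstat hfin hc
    have hpos : 0 < (∫⁻ b, totalVisits b ∂stackLaw Pr).toReal :=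
      ENNReal.toReal_pos (zero_lt_one.trans_le one_le_lintegral_totalVisits).ne' hfin
    filter_upwards [hlow, hup, ae_isUnboundedPath_coupledWalk hcookie] with q h1 h2 h3
    rw [ENNReal.toReal_inv]
    exact h3.tendsto_div hpos
      (fun c hc => h1 c (((ENNReal.ofReal_lt_ofReal_iff hpos).2 hc).trans_eq
        (ENNReal.ofReal_toReal hfin))) h2

lemma ae_tendsto_div (hcookie : ∀ᵐ ω ∂Pr, IsCookieEnv ω) (hstat : IsStatErgEnv Pr)
    {κ : Kernel CEnv (ℕ → ℤ)} [IsMarkovKernel κ] (hκ : ∀ ω, IsCookieEnv ω → IsERWLaw ω 0 (κ ω)) :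
    ∀ᵐ p ∂(Pr.compProd κ), Tendsto (fun n : ℕ => (p.2 n : ℝ) / n) atTop
      (𝓝 (∫⁻ b, totalVisits b ∂stackLaw Pr)⁻¹.toReal) := by
  have hS : MeasurableSet {Y : ℕ → ℤ | Tendsto (fun n : ℕ => (Y n : ℝ) / n) atTop
      (𝓝 (∫⁻ b, totalVisits b ∂stackLaw Pr)⁻¹.toReal)} :=
    measurableSet_tendsto _ fun n =>
      (Measurable.of_discrete (f := fun z : ℤ => (z : ℝ) / n)).comp (measurable_pi_apply n)
  have h := (ae_map_iff measurable_coupledWalk.aemeasurable hS).2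
    (ae_tendsto_coupledWalk_div hcookie hstat)
  rw [← map_snd_compProd_eq hcookie hκ] at h
  exact ae_of_ae_map measurable_snd.aemeasurable h

end PassageSpeed

/-- Theorem 17, strong law of large numbers. If `(ω(x))_{x≥0}` is
stationary and ergodic under `Pr` then `P_0`-a.s. `X_n/n → v = 1/u ≥ 0`, where
`u = ∑_{j≥1} P_0[T_{j+1} − T_j ≥ j] ∈ [1,∞]` (and `v = 0` when `u = ∞`). -/
theorem erw_slln (Pr : Measure CEnv) [IsProbabilityMeasure Pr]
    (hcookie : ∀ᵐ ω ∂Pr, IsCookieEnv ω)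
    (hstat : IsStatErgEnv Pr)
    (κ : Kernel CEnv (ℕ → ℤ)) [IsMarkovKernel κ]
    (hκ : ∀ ω, IsCookieEnv ω → IsERWLaw ω 0 (κ ω)) :
    (1 : ℝ≥0∞) ≤ ∑' j : ℕ, (Pr.compProd κ)
        {p | T ((j : ℤ) + 1) p.2 + ((j + 1 : ℕ) : ℕ∞) ≤ T ((j : ℤ) + 2) p.2} ∧
      ∀ᵐ p ∂(Pr.compProd κ),
        Tendsto (fun n : ℕ => (p.2 n : ℝ) / (n : ℝ)) atTop
          (𝓝 ((∑' j : ℕ, (Pr.compProd κ)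
            {p | T ((j : ℤ) + 1) p.2 + ((j + 1 : ℕ) : ℕ∞) ≤ T ((j : ℤ) + 2) p.2})⁻¹.toReal)) := by
  have hu : ∑' j : ℕ, (Pr.compProd κ)
      {p | T ((j : ℤ) + 1) p.2 + ((j + 1 : ℕ) : ℕ∞) ≤ T ((j : ℤ) + 2) p.2} =
      ∫⁻ b, totalVisits b ∂stackLaw Pr :=
    (tsum_congr (compProd_T_add_le_eq hcookie hstat hκ)).trans (tsum_stackLaw_eq hcookie hstat)
  rw [hu]
  exact ⟨one_le_lintegral_totalVisits, ae_tendsto_div hcookie hstat hκ⟩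

end
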